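/- arXiv:2207.03744 — 2 statements merged into one kernel-verified Lean document; each statement's English description precedes it below -/
import Mathlib

section
/- Let p > 1 and p' = p/(p − 1). Let T > 0, let u₀ ∈ L¹_loc(ℝ^{2N+1}) be nonnegative, f ∈ L¹_loc(ℝ^{2N+1}), and let u be a weak solution of u_t − Δ_ℍ u = |u|^p + f with datum u₀ on (0, T). Let ψ be a nonnegative admissible test function with ψ(T, ·) = 0 such that the quantities K₁ = ∫∫_{{ψ > 0}} ψ^{−1/(p−1)} |ψ_t|^{p/(p−1)} dη dt and K₂ = ∫∫_{{ψ > 0}} ψ^{−1/(p−1)} |Δ_ℍ ψ|^{p/(p−1)} dη dt are finite. Then ∫₀^T ∫_{ℝ^{2N+1}} f ψ dη dt ≤ (1/p') (2/p)^{p'−1} (K₁ + K₂). -/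
open MeasureTheory Real Set

noncomputable section

/-- Points of the Heisenberg group `ℍ^N`, written `η = (x, y, τ)`. -/
abbrev Heis (N : ℕ) : Type := (Fin N → ℝ) × (Fin N → ℝ) × ℝ

/-- Partial derivative `∂u/∂x_i`. -/
def pdx {N : ℕ} (i : Fin N) (u : Heis N → ℝ) (η : Heis N) : ℝ :=
  deriv (fun s => u (Function.update η.1 i s, η.2.1, η.2.2)) (η.1 i)

/-- Partial derivative `∂u/∂y_i`. -/
def pdy {N : ℕ} (i : Fin N) (u : Heis N → ℝ) (η : Heis N) : ℝ :=
  deriv (fun s => u (η.1, Function.update η.2.1 i s, η.2.2)) (η.2.1 i)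

/-- Partial derivative `∂u/∂τ`. -/
def pdt {N : ℕ} (u : Heis N → ℝ) (η : Heis N) : ℝ :=
  deriv (fun s => u (η.1, η.2.1, s)) η.2.2

/-- The sub-Laplacian on the Heisenberg group, in its explicit second-order form
`Δ_ℍ u = Σ_i (∂²u/∂x_i² + ∂²u/∂y_i² + 4 y_i ∂²u/(∂x_i ∂τ) − 4 x_i ∂²u/(∂y_i ∂τ)
  + 4 (x_i² + y_i²) ∂²u/∂τ²)`. -/
def subLaplacian {N : ℕ} (u : Heis N → ℝ) (η : Heis N) : ℝ :=
  ∑ i : Fin N,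
    (pdx i (pdx i u) η + pdy i (pdy i u) η
      + 4 * η.2.1 i * pdx i (pdt u) η
      - 4 * η.1 i * pdy i (pdt u) η
      + 4 * ((η.1 i) ^ 2 + (η.2.1 i) ^ 2) * pdt (pdt u) η)

/-- `|η|_ℍ⁴ = (|x|² + |y|²)² + τ²`. -/
def heisNorm4 {N : ℕ} (η : Heis N) : ℝ :=
  ((∑ i : Fin N, (η.1 i) ^ 2) + (∑ i : Fin N, (η.2.1 i) ^ 2)) ^ 2 + η.2.2 ^ 2

/-- The homogeneous norm `|η|_ℍ = ((|x|² + |y|²)² + τ²)^{1/4}`. -/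
def heisNorm {N : ℕ} (η : Heis N) : ℝ := heisNorm4 η ^ ((4 : ℝ)⁻¹)

/-- An admissible test function on `(0,T) × ℍ^N`: nonnegative, (at least) `C²`,
compactly supported, and vanishing at time `T`. -/
def IsTestFun (N : ℕ) (T : ℝ) (ψ : ℝ × Heis N → ℝ) : Prop :=
  ContDiff ℝ 2 ψ ∧ HasCompactSupport ψ ∧ (∀ z, 0 ≤ ψ z) ∧ ∀ η, ψ (T, η) = 0

/-- `u` is a weak solution of `u_t − Δ_ℍ u = |u|^p + f`, `u(0,·) = u₀`, on `(0,T)`. -/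
def IsWeakSol (N : ℕ) (p T : ℝ) (u₀ f : Heis N → ℝ) (u : ℝ × Heis N → ℝ) : Prop :=
  LocallyIntegrableOn u (Ioo (0 : ℝ) T ×ˢ (univ : Set (Heis N))) volume ∧
  LocallyIntegrableOn (fun z => |u z| ^ p) (Ioo (0 : ℝ) T ×ˢ (univ : Set (Heis N))) volume ∧
  ∀ ψ : ℝ × Heis N → ℝ, IsTestFun N T ψ →
    (∫ t in Ioo (0 : ℝ) T, ∫ η, |u (t, η)| ^ p * ψ (t, η))
      + (∫ η, u₀ η * ψ (0, η))
      + (∫ t in Ioo (0 : ℝ) T, ∫ η, f η * ψ (t, η))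
    = -(∫ t in Ioo (0 : ℝ) T, ∫ η, u (t, η) * deriv (fun s => ψ (s, η)) t)
      - (∫ t in Ioo (0 : ℝ) T, ∫ η, u (t, η) * subLaplacian (fun ξ => ψ (t, ξ)) η)

/-- The directional derivative of `ψ` along `v`. -/
def dirDeriv {E : Type*} [NormedAddCommGroup E] [NormedSpace ℝ E] (v : E) (ψ : E → ℝ) (z : E) : ℝ :=
  fderiv ℝ ψ z v

section DirDeriv

variable {E : Type*} [NormedAddCommGroup E] [NormedSpace ℝ E]

lemma ContDiff.dirDeriv {m n : WithTop ℕ∞} {ψ : E → ℝ} (h : ContDiff ℝ n ψ) (hmn : m + 1 ≤ n)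
    (v : E) : ContDiff ℝ m (dirDeriv v ψ) :=
  (h.fderiv_right hmn).clm_apply contDiff_const

lemma dirDeriv_add {ψ φ : E → ℝ} (hψ : Differentiable ℝ ψ) (hφ : Differentiable ℝ φ) (v : E) :
    dirDeriv v (ψ + φ) = dirDeriv v ψ + dirDeriv v φ := by
  ext z
  simp [_root_.dirDeriv, fderiv_add (hψ z) (hφ z)]

lemma Filter.EventuallyEq.dirDeriv {ψ φ : E → ℝ} {z : E} (h : ψ =ᶠ[nhds z] φ) (v : E) :
    dirDeriv v ψ =ᶠ[nhds z] dirDeriv v φ := by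
  filter_upwards [h.fderiv (𝕜 := ℝ)] with x hx
  simp [_root_.dirDeriv, hx]

/-- The derivative of a `C¹` function vanishes at almost every zero of the function. -/
lemma ae_dirDeriv_eq_zero [FiniteDimensional ℝ E] [MeasurableSpace E] [BorelSpace E]
    (μ : Measure E) [μ.IsAddHaarMeasure] {g : E → ℝ} (hg : ContDiff ℝ 1 g) (v : E) :
    ∀ᵐ z ∂μ, g z = 0 → dirDeriv v g z = 0 := by
  have hs : MeasurableSet {z | g z = 0} := (isClosed_eq hg.continuous continuous_const).measurableSet
  rcases eq_or_ne v 0 with rfl | hv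
  · simp [_root_.dirDeriv]
  have happ : ApproximatesLinearOn (fun x => g x • v) (0 : E →L[ℝ] E) {z | g z = 0} 0 := by
    intro x hx y hy
    simp only [mem_ofPred_eq] at hx hy
    simp [hx, hy]
  have h := happ.norm_fderiv_sub_le μ hs (fun x => (fderiv ℝ g x).smulRight v)
    (fun x _ => ((hg.differentiable one_ne_zero x).hasFDerivAt.smul_const v).hasFDerivWithinAt)
  rw [ae_restrict_iff' hs] at h
  filter_upwards [h] with z hz h0
  have h1 : fderiv ℝ g z = 0 ∨ v = 0 := by simpa using hz h0
  simp [_root_.dirDeriv, h1.resolve_right hv]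

end DirDeriv

section Heisenberg

variable {N : ℕ}

/-- The sub-Laplacian in the space variables of a function of time and space, in terms of
directional derivatives. -/
def slicedSubLaplacian (ψ : ℝ × Heis N → ℝ) (z : ℝ × Heis N) : ℝ :=
  ∑ i : Fin N,
    (dirDeriv (0, Pi.single i 1, 0, 0) (dirDeriv (0, Pi.single i 1, 0, 0) ψ) z
      + dirDeriv (0, 0, Pi.single i 1, 0) (dirDeriv (0, 0, Pi.single i 1, 0) ψ) z
      + 4 * z.2.2.1 i * dirDeriv (0, Pi.single i 1, 0, 0) (dirDeriv (0, 0, 0, 1) ψ) z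
      - 4 * z.2.1 i * dirDeriv (0, 0, Pi.single i 1, 0) (dirDeriv (0, 0, 0, 1) ψ) z
      + 4 * ((z.2.1 i) ^ 2 + (z.2.2.1 i) ^ 2) *
        dirDeriv (0, 0, 0, 1) (dirDeriv (0, 0, 0, 1) ψ) z)

variable {ψ φ : ℝ × Heis N → ℝ}

lemma deriv_time_eq (hψ : Differentiable ℝ ψ) (z : ℝ × Heis N) :
    deriv (fun s => ψ (s, z.2)) z.1 = dirDeriv (1, 0) ψ z := by
  have h : HasDerivAt (fun s : ℝ => (s, z.2)) ((1, 0) : ℝ × Heis N) z.1 :=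
    (hasDerivAt_id z.1).prodMk (hasDerivAt_const _ _)
  exact ((hψ z).hasFDerivAt.comp_hasDerivAt z.1 h).deriv

lemma pdx_slice (hψ : Differentiable ℝ ψ) (t : ℝ) (i : Fin N) :
    pdx i (fun ξ => ψ (t, ξ)) = fun ξ => dirDeriv (0, Pi.single i 1, 0, 0) ψ (t, ξ) := by
  ext η
  have h : HasDerivAt (fun s : ℝ => ((t, Function.update η.1 i s, η.2.1, η.2.2) : ℝ × Heis N))
      (0, Pi.single i 1, 0, 0) (η.1 i) :=
    (hasDerivAt_const _ _).prodMk ((hasDerivAt_update _ _ _).prodMk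
      ((hasDerivAt_const _ _).prodMk (hasDerivAt_const _ _)))
  refine HasDerivAt.deriv (HasFDerivAt.comp_hasDerivAt (η.1 i) ?_ h)
  rw [Function.update_eq_self]
  exact (hψ (t, η)).hasFDerivAt

lemma pdy_slice (hψ : Differentiable ℝ ψ) (t : ℝ) (i : Fin N) :
    pdy i (fun ξ => ψ (t, ξ)) = fun ξ => dirDeriv (0, 0, Pi.single i 1, 0) ψ (t, ξ) := by
  ext η
  have h : HasDerivAt (fun s : ℝ => ((t, η.1, Function.update η.2.1 i s, η.2.2) : ℝ × Heis N))
      (0, 0, Pi.single i 1, 0) (η.2.1 i) :=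
    (hasDerivAt_const _ _).prodMk ((hasDerivAt_const _ _).prodMk
      ((hasDerivAt_update _ _ _).prodMk (hasDerivAt_const _ _)))
  refine HasDerivAt.deriv (HasFDerivAt.comp_hasDerivAt (η.2.1 i) ?_ h)
  rw [Function.update_eq_self]
  exact (hψ (t, η)).hasFDerivAt

lemma pdt_slice (hψ : Differentiable ℝ ψ) (t : ℝ) :
    pdt (fun ξ => ψ (t, ξ)) = fun ξ => dirDeriv (0, 0, 0, 1) ψ (t, ξ) := by
  ext η
  have h : HasDerivAt (fun s : ℝ => ((t, η.1, η.2.1, s) : ℝ × Heis N)) (0, 0, 0, 1) η.2.2 :=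
    (hasDerivAt_const _ _).prodMk ((hasDerivAt_const _ _).prodMk
      ((hasDerivAt_const _ _).prodMk (hasDerivAt_id _)))
  exact ((hψ (t, η)).hasFDerivAt.comp_hasDerivAt η.2.2 h).deriv

lemma subLaplacian_slice (hψ : ContDiff ℝ 2 ψ) (z : ℝ × Heis N) :
    subLaplacian (fun ξ => ψ (z.1, ξ)) z.2 = slicedSubLaplacian ψ z := by
  have h0 : Differentiable ℝ ψ := hψ.differentiable two_ne_zero
  have h1 (v) : Differentiable ℝ (dirDeriv v ψ) :=
    (hψ.dirDeriv (m := 1) (by norm_num) v).differentiable one_ne_zero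
  simp only [subLaplacian, slicedSubLaplacian, pdx_slice h0, pdy_slice h0, pdt_slice h0,
    pdx_slice (h1 _), pdy_slice (h1 _), pdt_slice (h1 _)]

lemma ContDiff.slicedSubLaplacian {m n : WithTop ℕ∞} (hψ : ContDiff ℝ n ψ) (hmn : m + 1 + 1 ≤ n) :
    ContDiff ℝ m (slicedSubLaplacian ψ) := by
  have h2 (v w) : ContDiff ℝ m (_root_.dirDeriv w (_root_.dirDeriv v ψ)) :=
    ContDiff.dirDeriv (ContDiff.dirDeriv hψ hmn v) le_rfl w
  unfold _root_.slicedSubLaplacian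
  refine ContDiff.sum fun i _ => ?_
  have := h2
  fun_prop

lemma slicedSubLaplacian_add (hψ : ContDiff ℝ 2 ψ) (hφ : ContDiff ℝ 2 φ) :
    slicedSubLaplacian (ψ + φ) = slicedSubLaplacian ψ + slicedSubLaplacian φ := by
  have h1 {χ : ℝ × Heis N → ℝ} (h : ContDiff ℝ 2 χ) (v) : Differentiable ℝ (dirDeriv v χ) :=
    (h.dirDeriv (m := 1) (by norm_num) v).differentiable one_ne_zero
  ext z
  simp only [slicedSubLaplacian, dirDeriv_add (hψ.differentiable two_ne_zero)
    (hφ.differentiable two_ne_zero), dirDeriv_add (h1 hψ _) (h1 hφ _), Pi.add_apply,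
    ← Finset.sum_add_distrib]
  exact Finset.sum_congr rfl fun i _ => by ring

lemma slicedSubLaplacian_eq_zero_of_notMem_tsupport {z : ℝ × Heis N} (hz : z ∉ tsupport ψ) :
    slicedSubLaplacian ψ z = 0 := by
  have h := notMem_tsupport_iff_eventuallyEq.mp hz
  have h0 (v : ℝ × Heis N) : dirDeriv v (0 : ℝ × Heis N → ℝ) = 0 := by
    ext; simp [dirDeriv]
  have h2 (v w) : dirDeriv w (dirDeriv v ψ) z = 0 := by
    rw [((h.dirDeriv v).dirDeriv w).eq_of_nhds, h0, h0, Pi.zero_apply]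
  simp [slicedSubLaplacian, h2]

lemma dirDeriv_eq_zero_of_notMem_tsupport {z : ℝ × Heis N} (hz : z ∉ tsupport ψ)
    (v : ℝ × Heis N) : dirDeriv v ψ z = 0 := by
  rw [((notMem_tsupport_iff_eventuallyEq.mp hz).dirDeriv v).eq_of_nhds]
  simp [dirDeriv]

instance isAddHaarMeasure_volume_heis : (volume : Measure (Heis N)).IsAddHaarMeasure :=
  Measure.prod.instIsAddHaarMeasure _ ((volume : Measure (Fin N → ℝ)).prod (volume : Measure ℝ))

instance isAddHaarMeasure_volume_time_heis :
    (volume : Measure (ℝ × Heis N)).IsAddHaarMeasure :=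
  Measure.prod.instIsAddHaarMeasure _ _

lemma ae_slicedSubLaplacian_eq_zero (hψ : ContDiff ℝ 2 ψ) :
    ∀ᵐ z, ψ z = 0 → slicedSubLaplacian ψ z = 0 := by
  have hae (v w : ℝ × Heis N) : ∀ᵐ z, ψ z = 0 → dirDeriv w (dirDeriv v ψ) z = 0 := by
    filter_upwards [ae_dirDeriv_eq_zero volume (hψ.of_le one_le_two) v,
      ae_dirDeriv_eq_zero volume (hψ.dirDeriv (m := 1) (by norm_num) v) w] with z h1 h2 h0
    exact h2 (h1 h0)
  have hx := ae_all_iff.mpr fun i : Fin N =>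
    hae (0, Pi.single i 1, 0, 0) (0, Pi.single i 1, 0, 0)
  have hy := ae_all_iff.mpr fun i : Fin N =>
    hae (0, 0, Pi.single i 1, 0) (0, 0, Pi.single i 1, 0)
  have hxt := ae_all_iff.mpr fun i : Fin N => hae (0, 0, 0, 1) (0, Pi.single i 1, 0, 0)
  have hyt := ae_all_iff.mpr fun i : Fin N => hae (0, 0, 0, 1) (0, 0, Pi.single i 1, 0)
  filter_upwards [hx, hy, hxt, hyt, hae (0, 0, 0, 1) (0, 0, 0, 1)] with z h1 h2 h3 h4 h5 h0
  simp [slicedSubLaplacian, h1 _ h0, h2 _ h0, h3 _ h0, h4 _ h0, h5 h0]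

lemma subLaplacian_const_mul (c : ℝ) (θ : Heis N → ℝ) (η : Heis N) :
    subLaplacian (fun ξ => c * θ ξ) η = c * subLaplacian θ η := by
  have hx (i) (u : Heis N → ℝ) : pdx i (fun ξ => c * u ξ) = fun ξ => c * pdx i u ξ := by
    ext ξ; simp [pdx, deriv_const_mul_field]
  have hy (i) (u : Heis N → ℝ) : pdy i (fun ξ => c * u ξ) = fun ξ => c * pdy i u ξ := by
    ext ξ; simp [pdy, deriv_const_mul_field]
  have ht (u : Heis N → ℝ) : pdt (fun ξ => c * u ξ) = fun ξ => c * pdt u ξ := by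
    ext ξ; simp [pdt, deriv_const_mul_field]
  simp only [subLaplacian, hx, hy, ht, Finset.mul_sum]
  exact Finset.sum_congr rfl fun i _ => by ring

lemma contDiff_comp_snd {n : WithTop ℕ∞} {θ : Heis N → ℝ} (hθ : ContDiff ℝ n θ) :
    ContDiff ℝ n (fun z : ℝ × Heis N => θ z.2) := hθ.comp contDiff_snd

lemma subLaplacian_eq_sliced {θ : Heis N → ℝ} (hθ : ContDiff ℝ 2 θ) (t : ℝ) (η : Heis N) :
    subLaplacian θ η = slicedSubLaplacian (fun z => θ z.2) (t, η) :=
  subLaplacian_slice (contDiff_comp_snd hθ) (t, η)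

lemma subLaplacian_add {θ ζ : Heis N → ℝ} (hθ : ContDiff ℝ 2 θ) (hζ : ContDiff ℝ 2 ζ)
    (η : Heis N) :
    subLaplacian (fun ξ => θ ξ + ζ ξ) η = subLaplacian θ η + subLaplacian ζ η := by
  rw [subLaplacian_eq_sliced (hθ.add hζ) 0, subLaplacian_eq_sliced hθ 0,
    subLaplacian_eq_sliced hζ 0]
  exact congrFun (slicedSubLaplacian_add (contDiff_comp_snd hθ) (contDiff_comp_snd hζ)) (0, η)

lemma contDiff_subLaplacian {m n : WithTop ℕ∞} {θ : Heis N → ℝ} (hθ : ContDiff ℝ n θ)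
    (hmn : m + 1 + 1 ≤ n) : ContDiff ℝ m (subLaplacian θ) := by
  have h2 : (2 : WithTop ℕ∞) ≤ n := by
    refine le_trans ?_ hmn
    rw [add_assoc, one_add_one_eq_two]
    exact le_add_self
  have h : subLaplacian θ = fun η => slicedSubLaplacian (fun z => θ z.2) ((0 : ℝ), η) :=
    funext fun η => subLaplacian_eq_sliced (hθ.of_le h2) 0 η
  rw [h]
  exact ((contDiff_comp_snd hθ).slicedSubLaplacian hmn).comp (contDiff_const.prodMk contDiff_id)

lemma subLaplacian_eq_zero_of_notMem_tsupport {θ : Heis N → ℝ} (hθ : ContDiff ℝ 2 θ) {η : Heis N}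
    (hη : η ∉ tsupport θ) : subLaplacian θ η = 0 := by
  rw [subLaplacian_eq_sliced hθ 0]
  refine slicedSubLaplacian_eq_zero_of_notMem_tsupport fun h => hη ?_
  exact tsupport_comp_subset_preimage θ continuous_snd h

lemma hasCompactSupport_subLaplacian {θ : Heis N → ℝ} (hθ : ContDiff ℝ 2 θ)
    (h : HasCompactSupport θ) : HasCompactSupport (subLaplacian θ) :=
  HasCompactSupport.intro h fun _ => subLaplacian_eq_zero_of_notMem_tsupport hθ

end Heisenberg

section OneDimensional

open scoped ContDiff

lemma MeasureTheory.LocallyIntegrableOn.integrable_mul_of_tsupport_subset {E : Type*}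
    [MetricSpace E] [SecondCountableTopology E] [MeasurableSpace E] [OpensMeasurableSpace E]
    {μ : Measure E} {U : Set E} {g χ : E → ℝ} (hg : LocallyIntegrableOn g U μ)
    (hχ : Continuous χ) (hc : HasCompactSupport χ) (hU : tsupport χ ⊆ U) :
    Integrable (fun x => χ x * g x) μ := by
  have h := (hg.integrableOn_compact_subset hU hc).continuousOn_mul hχ.continuousOn hc
  refine h.integrable_of_forall_notMem_eq_zero fun x hx => ?_
  rw [image_eq_zero_of_notMem_tsupport hx, zero_mul]

lemma exists_smooth_cutoff_Ioo {T : ℝ} (hT : 0 < T) {K : Set ℝ} (hK : IsClosed K)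
    (hKT : K ⊆ Ioo 0 T) :
    ∃ ρ : ℝ → ℝ, ContDiff ℝ ∞ ρ ∧ HasCompactSupport ρ ∧ tsupport ρ ⊆ Ioo 0 T ∧ (∀ t, 0 ≤ ρ t) ∧
      (∀ t ∈ K, ρ t = 1) ∧ 0 < ∫ t, ρ t := by
  have hball : Metric.ball (T / 2) (T / 2) = Ioo 0 T := by
    rw [Real.ball_eq_Ioo]; ring_nf
  obtain ⟨r, hr, hKr⟩ := exists_lt_subset_ball hK (hball ▸ hKT)
  set a := max r (T / 4) with ha
  have ha0 : 0 < a := lt_max_of_lt_right (by linarith)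
  have haT : a < T / 2 := max_lt hr (by linarith)
  let B : ContDiffBump (T / 2) := ⟨a, (a + T / 2) / 2, ha0, by linarith⟩
  refine ⟨B, B.contDiff, B.hasCompactSupport, ?_, fun _ => B.nonneg, fun t ht => ?_,
    B.integral_pos⟩
  · rw [B.tsupport_eq, ← hball]
    exact Metric.closedBall_subset_ball (show (a + T / 2) / 2 < T / 2 by linarith)
  · refine B.one_of_mem_closedBall ?_
    exact Metric.ball_subset_closedBall (Metric.ball_subset_ball (le_max_left _ _) (hKr ht))

/-- A linear relation tested by nonnegative test functions holds for all test functions. -/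
lemma integral_testing_eq_zero_of_nonneg {T : ℝ} (hT : 0 < T) {A g : ℝ → ℝ}
    (hA : LocallyIntegrableOn A (Ioo 0 T)) (hg : LocallyIntegrableOn g (Ioo 0 T))
    (h : ∀ χ : ℝ → ℝ, ContDiff ℝ ∞ χ → HasCompactSupport χ → tsupport χ ⊆ Ioo 0 T →
      (∀ t, 0 ≤ χ t) → ∫ t, (χ t * A t + deriv χ t * g t) = 0)
    {χ : ℝ → ℝ} (hχ : ContDiff ℝ ∞ χ) (hc : HasCompactSupport χ) (hU : tsupport χ ⊆ Ioo 0 T) :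
    ∫ t, (χ t * A t + deriv χ t * g t) = 0 := by
  have hint {ξ : ℝ → ℝ} (hξ : ContDiff ℝ ∞ ξ) (hc : HasCompactSupport ξ)
      (hU : tsupport ξ ⊆ Ioo 0 T) : Integrable (fun t => ξ t * A t + deriv ξ t * g t) :=
    (hA.integrable_mul_of_tsupport_subset hξ.continuous hc hU).add
      (hg.integrable_mul_of_tsupport_subset (contDiff_infty_iff_deriv.mp hξ).2.continuous hc.deriv
        ((tsupport_deriv_subset (f := ξ)).trans hU))
  obtain ⟨ρ, hρ, hρc, hρU, hρ0, hρ1, -⟩ := exists_smooth_cutoff_Ioo hT (isClosed_tsupport χ) hU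
  obtain ⟨M, hM⟩ := hc.exists_bound_of_continuous hχ.continuous
  have hM0 : 0 ≤ M := (norm_nonneg _).trans (hM 0)
  have hMρ : ContDiff ℝ ∞ (fun t => M * ρ t) := contDiff_const.mul hρ
  have hMρc : HasCompactSupport (fun t => M * ρ t) := hρc.mul_left
  have hMρU : tsupport (fun t => M * ρ t) ⊆ Ioo 0 T := (tsupport_mul_subset_right).trans hρU
  have hsU : tsupport (fun t => χ t + M * ρ t) ⊆ Ioo 0 T :=
    (tsupport_add χ fun t => M * ρ t).trans (union_subset hU hMρU)
  have h1 := h _ hMρ hMρc hMρU fun t => mul_nonneg hM0 (hρ0 t)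
  have h2 := h _ (hχ.add hMρ) (hc.add hMρc) hsU fun t => by
    by_cases ht : t ∈ tsupport χ
    · rw [hρ1 t ht, mul_one]
      linarith [neg_le_of_abs_le (hM t)]
    · rw [image_eq_zero_of_notMem_tsupport ht, zero_add]
      exact mul_nonneg hM0 (hρ0 t)
  rw [← sub_eq_zero.mpr (h2.trans h1.symm),
    ← integral_sub (hint (hχ.add hMρ) (hc.add hMρc) hsU) (hint hMρ hMρc hMρU)]
  refine integral_congr_ae (.of_forall fun t => ?_)
  have hd : deriv (fun t => χ t + M * ρ t) t = deriv χ t + deriv (fun t => M * ρ t) t :=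
    deriv_fun_add (hχ.differentiable (by simp) t) (hMρ.differentiable (by simp) t)
  simp only [hd]
  ring

lemma exists_primitive_of_integral_eq_zero {T : ℝ} {ζ : ℝ → ℝ}
    (hζ : ContDiff ℝ ∞ ζ) (hc : HasCompactSupport ζ) (hU : tsupport ζ ⊆ Ioo 0 T)
    (h0 : ∫ t, ζ t = 0) :
    ∃ χ : ℝ → ℝ, ContDiff ℝ ∞ χ ∧ HasCompactSupport χ ∧ tsupport χ ⊆ Ioo 0 T ∧ deriv χ = ζ := by
  have hball : Metric.ball (T / 2) (T / 2) = Ioo 0 T := by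
    rw [Real.ball_eq_Ioo]; ring_nf
  obtain ⟨r, hr, hζr⟩ := exists_lt_subset_ball hc.isClosed (hball ▸ hU)
  rw [Real.ball_eq_Ioo] at hζr
  have hz (t : ℝ) (ht : t ∉ Ioo (T / 2 - r) (T / 2 + r)) : ζ t = 0 :=
    image_eq_zero_of_notMem_tsupport fun h => ht (hζr h)
  let χ : ℝ → ℝ := fun t => ∫ s in (T / 2 - r)..t, ζ s
  have hd : ∀ t, HasDerivAt χ (ζ t) t := fun t => hζ.continuous.integral_hasStrictDerivAt _ t
    |>.hasDerivAt
  have hderiv : deriv χ = ζ := funext fun t => (hd t).deriv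
  have hsupp : ∀ t ∉ Icc (T / 2 - r) (T / 2 + r), χ t = 0 := by
    intro t ht
    rw [mem_Icc, not_and_or, not_le, not_le] at ht
    rcases ht with ht | ht
    · refine (intervalIntegral.integral_congr (g := fun _ => (0 : ℝ)) fun s hs => ?_).trans
        intervalIntegral.integral_zero
      rw [uIcc_of_ge ht.le] at hs
      exact hz s fun h => absurd h.1 (not_lt.mpr hs.2)
    · rw [← h0]
      rcases le_or_gt r 0 with hr0 | hr0
      · have : ζ = fun _ => 0 := funext fun s => hz s fun h => by linarith [h.1, h.2]
        simp [χ, this]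
      refine intervalIntegral.integral_eq_integral_of_support_subset fun s hs => ?_
      by_contra hs'
      refine hs (hz s fun h => hs' ⟨h.1, h.2.le.trans ht.le⟩)
  refine ⟨χ, ?_, HasCompactSupport.intro isCompact_Icc hsupp, ?_, hderiv⟩
  · rw [contDiff_infty_iff_deriv, hderiv]
    exact ⟨fun t => (hd t).differentiableAt, hζ⟩
  · have hI : Icc (T / 2 - r) (T / 2 + r) ⊆ Ioo 0 T := Icc_subset_Ioo (by linarith) (by linarith)
    refine (closure_minimal (fun t ht => ?_) isClosed_Icc).trans hI
    by_contra h
    exact ht (hsupp t h)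

/-- A locally integrable function whose weak derivative is constant on a bounded interval is
integrable there. -/
lemma integrableOn_of_weak_deriv_const {T : ℝ} (hT : 0 < T) {g : ℝ → ℝ}
    (hg : LocallyIntegrableOn g (Ioo 0 T)) (F : ℝ)
    (h : ∀ χ : ℝ → ℝ, ContDiff ℝ ∞ χ → HasCompactSupport χ → tsupport χ ⊆ Ioo 0 T →
      (∀ t, 0 ≤ χ t) → ∫ t, (χ t * F + deriv χ t * g t) = 0) :
    IntegrableOn g (Ioo 0 T) := by
  have haff : LocallyIntegrableOn (fun t : ℝ => F * t) (Ioo 0 T) :=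
    (continuous_const.mul continuous_id).locallyIntegrable.locallyIntegrableOn _
  have hgF : LocallyIntegrableOn (fun t => g t - F * t) (Ioo 0 T) := hg.sub haff
  have hFc : LocallyIntegrableOn (fun _ : ℝ => F) (Ioo 0 T) :=
    continuous_const.locallyIntegrable.locallyIntegrableOn _
  have key {χ : ℝ → ℝ} (hχ : ContDiff ℝ ∞ χ) (hc : HasCompactSupport χ)
      (hU : tsupport χ ⊆ Ioo 0 T) : ∫ t, deriv χ t * (g t - F * t) = 0 := by
    have hχ' : Continuous (deriv χ) := (contDiff_infty_iff_deriv.mp hχ).2.continuous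
    have hU' : tsupport (deriv χ) ⊆ Ioo 0 T := (tsupport_deriv_subset (f := χ)).trans hU
    have i1 : Integrable (fun t => χ t * F) := hFc.integrable_mul_of_tsupport_subset hχ.continuous hc hU
    have i2 := haff.integrable_mul_of_tsupport_subset hχ' hc.deriv hU'
    have i3 := hg.integrable_mul_of_tsupport_subset hχ' hc.deriv hU'
    have i4 := haff.integrable_mul_of_tsupport_subset hχ.continuous hc hU
    have hparts : ∫ t, χ t * F = - ∫ t, deriv χ t * (F * t) :=
      integral_mul_deriv_eq_deriv_mul_of_integrable (u := χ) (v := fun t => F * t)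
        (fun t _ => (hχ.differentiable (by simp) t).hasDerivAt)
        (fun t _ => by simpa using (hasDerivAt_id t).const_mul F) i1 i2 i4
    have hrel := integral_testing_eq_zero_of_nonneg hT hFc hg h hχ hc hU
    rw [integral_add i1 i3, hparts] at hrel
    have hs : ∀ t, deriv χ t * (g t - F * t) = deriv χ t * g t - deriv χ t * (F * t) :=
      fun t => mul_sub _ _ _
    simp_rw [hs]
    rw [integral_sub i3 i2]
    linarith
  obtain ⟨ρ, hρ, hρc, hρU, -, -, hρpos⟩ :=
    exists_smooth_cutoff_Ioo hT isClosed_empty (empty_subset _)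
  set d : ℝ := (∫ t, ρ t * (g t - F * t)) / ∫ t, ρ t with hd
  have hdc : LocallyIntegrableOn (fun _ : ℝ => d) (Ioo 0 T) :=
    continuous_const.locallyIntegrable.locallyIntegrableOn _
  have hzero : ∀ᵐ t : ℝ, t ∈ Ioo 0 T → g t - F * t - d = 0 := by
    refine isOpen_Ioo.ae_eq_zero_of_integral_contDiff_smul_eq_zero (hgF.sub hdc) ?_
    intro ξ hξ hξc hξU
    set c : ℝ := (∫ t, ξ t) / ∫ t, ρ t with hcdef
    have hcρ : ContDiff ℝ ∞ (fun t => c * ρ t) := contDiff_const.mul hρ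
    have hcρc : HasCompactSupport (fun t => c * ρ t) := hρc.mul_left
    have hcρU : tsupport (fun t => c * ρ t) ⊆ Ioo 0 T := (tsupport_mul_subset_right).trans hρU
    have iξ : Integrable ξ := hξ.continuous.integrable_of_hasCompactSupport hξc
    have iρ : Integrable ρ := hρ.continuous.integrable_of_hasCompactSupport hρc
    obtain ⟨χ, hχ, hχc, hχU, hχd⟩ := exists_primitive_of_integral_eq_zero (hξ.sub hcρ)
      (hξc.sub hcρc) ((tsupport_sub ξ fun t => c * ρ t).trans (union_subset hξU hcρU)) (by
        rw [integral_sub iξ (iρ.const_mul c), integral_const_mul, hcdef,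
          div_mul_cancel₀ _ hρpos.ne', sub_self])
    have hk := key hχ hχc hχU
    rw [hχd] at hk
    have i1 := hgF.integrable_mul_of_tsupport_subset hξ.continuous hξc hξU
    have i2 := hgF.integrable_mul_of_tsupport_subset hρ.continuous hρc hρU
    have e1 : ∀ t, (ξ t - c * ρ t) * (g t - F * t)
        = ξ t * (g t - F * t) - c * (ρ t * (g t - F * t)) := fun t => by ring
    simp_rw [e1] at hk
    rw [integral_sub i1 (i2.const_mul c), integral_const_mul] at hk
    have e2 : ∀ t, ξ t • (g t - F * t - d) = ξ t * (g t - F * t) - ξ t * d := fun t => by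
      rw [smul_eq_mul]; ring
    simp only [e2]
    rw [integral_sub i1 (iξ.mul_const d), integral_mul_const]
    have : (∫ t, ξ t) * d = c * ∫ t, ρ t * (g t - F * t) := by
      rw [hd, hcdef]; ring
    linarith
  have hI : IntegrableOn (fun t => F * t + d) (Ioo 0 T) :=
    ((by fun_prop : Continuous fun t : ℝ => F * t + d).integrableOn_Icc (a := 0) (b := T)).mono_set
      Ioo_subset_Icc_self
  refine hI.congr ?_
  rw [Filter.EventuallyEq, ae_restrict_iff' measurableSet_Ioo]
  filter_upwards [hzero] with t ht hm
  linarith [ht hm]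

end OneDimensional

section SpaceIntegral

open scoped ContDiff

variable {N : ℕ}

lemma volume_restrict_prod_univ (s : Set ℝ) :
    (volume : Measure (ℝ × Heis N)).restrict (s ×ˢ univ) = (volume.restrict s).prod volume := by
  rw [Measure.volume_eq_prod, ← Measure.prod_restrict, Measure.restrict_univ]

/-- The pairing of the time slice `w (t, ·)` with `θ`. -/
def spaceIntegral (w : ℝ × Heis N → ℝ) (θ : Heis N → ℝ) (t : ℝ) : ℝ := ∫ η, w (t, η) * θ η

lemma exists_space_cutoff {K : Set (Heis N)} (hK : IsCompact K) :
    ∃ ρ : Heis N → ℝ, ContDiff ℝ ∞ ρ ∧ HasCompactSupport ρ ∧ (∀ η, 0 ≤ ρ η) ∧ ∀ η ∈ K, ρ η = 1 := by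
  obtain ⟨R, hR, hKR⟩ := hK.isBounded.subset_closedBall_lt 0 (0 : Heis N)
  let B : ContDiffBump (0 : Heis N) := ⟨R, R + 1, hR, by linarith⟩
  exact ⟨B, B.contDiff, B.hasCompactSupport, fun _ => B.nonneg,
    fun η hη => B.one_of_mem_closedBall (hKR hη)⟩

variable {T : ℝ} {w : ℝ × Heis N → ℝ} {θ : Heis N → ℝ}

lemma MeasureTheory.LocallyIntegrableOn.integrableOn_mul_comp_snd
    (hw : LocallyIntegrableOn w (Ioo (0 : ℝ) T ×ˢ univ)) (hθ : Continuous θ)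
    (hc : HasCompactSupport θ) {k : Set ℝ} (hk : k ⊆ Ioo 0 T) (hkc : IsCompact k) :
    Integrable (fun z => w z * θ z.2) ((volume.restrict k).prod volume) := by
  rw [← volume_restrict_prod_univ]
  have hK : IsCompact (k ×ˢ tsupport θ) := hkc.prod hc
  have h := (hw.integrableOn_compact_subset (prod_mono hk (subset_univ _)) hK).mul_continuousOn
    (hθ.comp continuous_snd).continuousOn hK
  refine IntegrableOn.of_forall_sdiff_eq_zero h (hkc.measurableSet.prod .univ) fun z hz => ?_
  rw [image_eq_zero_of_notMem_tsupport (f := θ) fun hm => hz.2 ⟨hz.1.1, hm⟩, mul_zero]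

lemma ae_integrable_slice (hw : LocallyIntegrableOn w (Ioo (0 : ℝ) T ×ˢ univ))
    (hθ : Continuous θ) (hc : HasCompactSupport θ) :
    ∀ᵐ t ∂volume.restrict (Ioo 0 T), Integrable fun η => w (t, η) * θ η := by
  refine ae_restrict_of_ae_restrict_inter_Ioo fun a b ha hb _ => ?_
  have h := hw.integrableOn_mul_comp_snd hθ hc (Icc_subset_Ioo ha.1 hb.2) isCompact_Icc
  exact ae_mono (Measure.restrict_mono (inter_subset_right.trans Ioo_subset_Icc_self) le_rfl)
    h.prod_right_ae

lemma locallyIntegrableOn_spaceIntegral (hw : LocallyIntegrableOn w (Ioo (0 : ℝ) T ×ˢ univ))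
    (hθ : Continuous θ) (hc : HasCompactSupport θ) :
    LocallyIntegrableOn (spaceIntegral w θ) (Ioo 0 T) :=
  (locallyIntegrableOn_iff isOpen_Ioo.isLocallyClosed).mpr fun _ hk hkc =>
    (hw.integrableOn_mul_comp_snd hθ hc hk hkc).integral_prod_left

lemma ae_spaceIntegral_add_mul (hw : LocallyIntegrableOn w (Ioo (0 : ℝ) T ×ˢ univ))
    {θ₁ θ₂ : Heis N → ℝ} (h₁ : Continuous θ₁) (hc₁ : HasCompactSupport θ₁)
    (h₂ : Continuous θ₂) (hc₂ : HasCompactSupport θ₂) (c₁ c₂ : ℝ → ℝ) :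
    ∀ᵐ t ∂volume.restrict (Ioo 0 T), spaceIntegral w (fun η => c₁ t * θ₁ η + c₂ t * θ₂ η) t
      = c₁ t * spaceIntegral w θ₁ t + c₂ t * spaceIntegral w θ₂ t := by
  filter_upwards [ae_integrable_slice hw h₁ hc₁, ae_integrable_slice hw h₂ hc₂] with t i₁ i₂
  have e (η) : w (t, η) * (c₁ t * θ₁ η + c₂ t * θ₂ η)
      = c₁ t * (w (t, η) * θ₁ η) + c₂ t * (w (t, η) * θ₂ η) := by ring
  simp only [spaceIntegral, e]
  rw [integral_add (i₁.const_mul _) (i₂.const_mul _), integral_const_mul, integral_const_mul]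

variable {p : ℝ} {u₀ f : Heis N → ℝ} {u : ℝ × Heis N → ℝ}

/-- The weak formulation tested against a sum of two tensor products. -/
lemma IsWeakSol.tensor_identity (hu : IsWeakSol N p T u₀ f u) (hu₀ : LocallyIntegrable u₀)
    (hf : LocallyIntegrable f) {θ₁ θ₂ : Heis N → ℝ} {χ₁ χ₂ : ℝ → ℝ}
    (h₁ : ContDiff ℝ 2 θ₁) (hc₁ : HasCompactSupport θ₁) (hp₁ : ∀ η, 0 ≤ θ₁ η)
    (h₂ : ContDiff ℝ 2 θ₂) (hc₂ : HasCompactSupport θ₂) (hp₂ : ∀ η, 0 ≤ θ₂ η)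
    (k₁ : ContDiff ℝ 2 χ₁) (kc₁ : HasCompactSupport χ₁) (kp₁ : ∀ t, 0 ≤ χ₁ t) (kT₁ : χ₁ T = 0)
    (k₂ : ContDiff ℝ 2 χ₂) (kc₂ : HasCompactSupport χ₂) (kp₂ : ∀ t, 0 ≤ χ₂ t) (kT₂ : χ₂ T = 0) :
    (∫ t in Ioo 0 T, (χ₁ t * spaceIntegral (fun z => |u z| ^ p) θ₁ t
        + χ₂ t * spaceIntegral (fun z => |u z| ^ p) θ₂ t))
      + (χ₁ 0 * (∫ η, u₀ η * θ₁ η) + χ₂ 0 * (∫ η, u₀ η * θ₂ η))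
      + ((∫ t in Ioo 0 T, χ₁ t) * (∫ η, f η * θ₁ η) + (∫ t in Ioo 0 T, χ₂ t) * (∫ η, f η * θ₂ η))
    = -(∫ t in Ioo 0 T, (deriv χ₁ t * spaceIntegral u θ₁ t + deriv χ₂ t * spaceIntegral u θ₂ t))
      - ∫ t in Ioo 0 T, (χ₁ t * spaceIntegral u (subLaplacian θ₁) t
        + χ₂ t * spaceIntegral u (subLaplacian θ₂) t) := by
  obtain ⟨hul, hupl, hweak⟩ := hu
  have hpair {g : Heis N → ℝ} (hg : LocallyIntegrable g) (c₁ c₂ : ℝ) :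
      ∫ η, g η * (c₁ * θ₁ η + c₂ * θ₂ η) = c₁ * (∫ η, g η * θ₁ η) + c₂ * (∫ η, g η * θ₂ η) := by
    have i₁ : Integrable fun η => g η * θ₁ η :=
      hg.integrable_smul_right_of_hasCompactSupport h₁.continuous hc₁
    have i₂ : Integrable fun η => g η * θ₂ η :=
      hg.integrable_smul_right_of_hasCompactSupport h₂.continuous hc₂
    have e (η) : g η * (c₁ * θ₁ η + c₂ * θ₂ η) = c₁ * (g η * θ₁ η) + c₂ * (g η * θ₂ η) := by ring
    simp only [e]
    rw [integral_add (i₁.const_mul _) (i₂.const_mul _), integral_const_mul, integral_const_mul]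
  have htens {χ : ℝ → ℝ} {θ : Heis N → ℝ} (hχ : HasCompactSupport χ) (hθ : HasCompactSupport θ) :
      HasCompactSupport fun z : ℝ × Heis N => χ z.1 * θ z.2 := by
    refine HasCompactSupport.intro (hχ.prod hθ) fun z hz => ?_
    by_cases h1 : z.1 ∈ tsupport χ
    · rw [image_eq_zero_of_notMem_tsupport (f := θ) fun h => hz ⟨h1, h⟩, mul_zero]
    · rw [image_eq_zero_of_notMem_tsupport h1, zero_mul]
  have htest : IsTestFun N T fun z => χ₁ z.1 * θ₁ z.2 + χ₂ z.1 * θ₂ z.2 := by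
    refine ⟨?_, (htens kc₁ hc₁).add (htens kc₂ hc₂), fun z => ?_, fun η => by simp [kT₁, kT₂]⟩
    · exact ((k₁.comp contDiff_fst).mul (h₁.comp contDiff_snd)).add
        ((k₂.comp contDiff_fst).mul (h₂.comp contDiff_snd))
    · exact add_nonneg (mul_nonneg (kp₁ _) (hp₁ _)) (mul_nonneg (kp₂ _) (hp₂ _))
  have key := hweak _ htest
  have hsub (c₁ c₂ : ℝ) (η : Heis N) : subLaplacian (fun ξ => c₁ * θ₁ ξ + c₂ * θ₂ ξ) η
      = c₁ * subLaplacian θ₁ η + c₂ * subLaplacian θ₂ η := by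
    rw [subLaplacian_add (contDiff_const.mul h₁) (contDiff_const.mul h₂), subLaplacian_const_mul,
      subLaplacian_const_mul]
  have hder (η : Heis N) (t : ℝ) : deriv (fun s => χ₁ s * θ₁ η + χ₂ s * θ₂ η) t
      = deriv χ₁ t * θ₁ η + deriv χ₂ t * θ₂ η := by
    have d₁ := (k₁.differentiable two_ne_zero t).hasDerivAt.mul_const (θ₁ η)
    have d₂ := (k₂.differentiable two_ne_zero t).hasDerivAt.mul_const (θ₂ η)
    exact (d₁.add d₂).deriv
  simp only [hsub, hder, hpair hu₀, hpair hf] at key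
  have e1 := integral_congr_ae
    (ae_spaceIntegral_add_mul hupl h₁.continuous hc₁ h₂.continuous hc₂ χ₁ χ₂)
  have e2 := integral_congr_ae
    (ae_spaceIntegral_add_mul hul h₁.continuous hc₁ h₂.continuous hc₂ (deriv χ₁) (deriv χ₂))
  have e3 := integral_congr_ae (ae_spaceIntegral_add_mul hul
    (contDiff_subLaplacian h₁ (m := 0) (by norm_num)).continuous
    (hasCompactSupport_subLaplacian h₁ hc₁)
    (contDiff_subLaplacian h₂ (m := 0) (by norm_num)).continuous
    (hasCompactSupport_subLaplacian h₂ hc₂) χ₁ χ₂)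
  have e4 : ∫ t in Ioo 0 T, (χ₁ t * (∫ η, f η * θ₁ η) + χ₂ t * (∫ η, f η * θ₂ η))
      = (∫ t in Ioo 0 T, χ₁ t) * (∫ η, f η * θ₁ η)
        + (∫ t in Ioo 0 T, χ₂ t) * (∫ η, f η * θ₂ η) := by
    have j₁ : IntegrableOn χ₁ (Ioo 0 T) :=
      (k₁.continuous.integrable_of_hasCompactSupport kc₁).integrableOn
    have j₂ : IntegrableOn χ₂ (Ioo 0 T) :=
      (k₂.continuous.integrable_of_hasCompactSupport kc₂).integrableOn
    rw [integral_add (j₁.mul_const _) (j₂.mul_const _), integral_mul_const, integral_mul_const]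
  rw [← e1, ← e2, ← e3, ← e4]
  exact key

end SpaceIntegral

section NearInitialTime

open scoped ContDiff

variable {N : ℕ} {T p : ℝ} {u₀ f : Heis N → ℝ} {u : ℝ × Heis N → ℝ}

/-- If the integral of the source against a test function is not defined, its value in the weak
formulation is zero, and comparing test functions that differ by a multiple of a function supported
away from the initial time gives a contradiction. Hence the source is integrable up to the initial
time. -/
lemma IsWeakSol.integrableOn_spaceIntegral_source (hu : IsWeakSol N p T u₀ f u) (hT : 0 < T)
    (hu₀ : LocallyIntegrable u₀) (hf : LocallyIntegrable f) {θ : Heis N → ℝ}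
    (hθ : ContDiff ℝ 4 θ) (hc : HasCompactSupport θ) (hθ0 : ∀ η, 0 ≤ θ η)
    {b : ℝ} (hb : 0 < b) (hbT : b < T) :
    IntegrableOn (spaceIntegral (fun z => |u z| ^ p) θ) (Ioo 0 b) := by
  obtain ⟨hul, hupl, -⟩ := id hu
  have hinf : (2 : WithTop ℕ∞) ≤ ∞ := ENat.LEInfty.out
  have hθ2 : ContDiff ℝ 2 θ := hθ.of_le (by norm_num)
  have hL2 : ContDiff ℝ 2 (subLaplacian θ) := contDiff_subLaplacian hθ (by norm_num)
  have hLc := hasCompactSupport_subLaplacian hθ2 hc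
  let B : ContDiffBump (0 : ℝ) := ⟨b, (b + T) / 2, hb, by linarith⟩
  have hB0 : ∀ t, 0 ≤ B t := fun _ => B.nonneg
  have hBd : ContDiff ℝ ∞ B := B.contDiff
  have hBout {t : ℝ} (ht : (b + T) / 2 ≤ t) : B t = 0 :=
    B.zero_of_le_dist (by rw [dist_zero_right]; exact ht.trans (le_abs_self t))
  have hB1 : ∀ t ∈ Ioo 0 b, B t = 1 := fun t ht => B.one_of_mem_closedBall (by
    rw [mem_closedBall_zero_iff, Real.norm_eq_abs, abs_of_pos ht.1]; exact ht.2.le)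
  have hBT : B T = 0 := hBout (by linarith)
  -- the time derivative of the cutoff is supported in a compact subinterval
  have hdB : IntegrableOn (fun t => deriv B t * spaceIntegral u θ t) (Ioo 0 T) := by
    have hsub : Icc b ((b + T) / 2) ⊆ Ioo 0 T := Icc_subset_Ioo hb (by linarith)
    have h := ((locallyIntegrableOn_spaceIntegral hul hθ.continuous hc).integrableOn_compact_subset
      hsub isCompact_Icc).continuousOn_mul
        (contDiff_infty_iff_deriv.mp hBd).2.continuous.continuousOn isCompact_Icc
    refine IntegrableOn.of_forall_sdiff_eq_zero h measurableSet_Ioo fun t ht => ?_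
    have hd : deriv B t = 0 := by
      rcases lt_or_ge t b with h' | h'
      · have : B =ᶠ[nhds t] fun _ => (1 : ℝ) := by
          filter_upwards [isOpen_Ioo.mem_nhds (show t ∈ Ioo 0 b from ⟨ht.1.1, h'⟩)] with s hs
          exact hB1 s hs
        rw [this.deriv_eq, deriv_const]
      · have h2 : (b + T) / 2 < t := lt_of_not_ge fun h2 => ht.2 ⟨h', h2⟩
        have : B =ᶠ[nhds t] fun _ => (0 : ℝ) := by
          filter_upwards [Ioi_mem_nhds h2] with s hs
          exact hBout (le_of_lt hs)
        rw [this.deriv_eq, deriv_const]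
    rw [hd, zero_mul]
  by_contra hnot
  have hA : ¬ IntegrableOn (fun t => B t * spaceIntegral (fun z => |u z| ^ p) θ t) (Ioo 0 T) :=
    fun h => hnot ((h.mono_set (Ioo_subset_Ioo_right hbT.le)).congr_fun
      (fun t ht => by simp only [hB1 t ht, one_mul]) measurableSet_Ioo)
  have tens {χ : ℝ → ℝ} (hχ : Continuous χ) (hχc : HasCompactSupport χ)
      (hU : tsupport χ ⊆ Ioo 0 T) {w : ℝ × Heis N → ℝ}
      (hw : LocallyIntegrableOn w (Ioo (0 : ℝ) T ×ˢ univ)) {ζ : Heis N → ℝ} (hζ : Continuous ζ)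
      (hζc : HasCompactSupport ζ) : Integrable (fun t => χ t * spaceIntegral w ζ t) :=
    (locallyIntegrableOn_spaceIntegral hw hζ hζc).integrable_mul_of_tsupport_subset hχ hχc hU
  have whole {χ g : ℝ → ℝ} (hU : tsupport χ ⊆ Ioo 0 T) :
      ∫ t in Ioo 0 T, χ t * g t = ∫ t, χ t * g t :=
    setIntegral_eq_integral_of_forall_compl_eq_zero fun t ht => by
      rw [image_eq_zero_of_notMem_tsupport fun h => ht (hU h), zero_mul]
  have whole' {χ : ℝ → ℝ} (hU : tsupport χ ⊆ Ioo 0 T) :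
      ∫ t in Ioo 0 T, χ t = ∫ t, χ t :=
    setIntegral_eq_integral_of_forall_compl_eq_zero fun t ht =>
      image_eq_zero_of_notMem_tsupport fun h => ht (hU h)
  have hz0 : HasCompactSupport (fun _ : ℝ => (0 : ℝ)) := HasCompactSupport.zero
  -- the difference of two weak formulations in which the source term is undefined
  have diff {χ : ℝ → ℝ} (hχ : ContDiff ℝ ∞ χ) (hχc : HasCompactSupport χ)
      (hU : tsupport χ ⊆ Ioo 0 T) (hχ0 : ∀ t, 0 ≤ χ t) {ζ : Heis N → ℝ} (hζ : ContDiff ℝ 2 ζ)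
      (hζc : HasCompactSupport ζ) (hζ0 : ∀ η, 0 ≤ ζ η) :
      (∫ t, χ t) * (∫ η, f η * ζ η) = - (∫ t, deriv χ t * spaceIntegral u ζ t)
        - ((∫ t in Ioo 0 T, (B t * spaceIntegral u (subLaplacian θ) t
            + χ t * spaceIntegral u (subLaplacian ζ) t))
          - ∫ t in Ioo 0 T, B t * spaceIntegral u (subLaplacian θ) t) := by
    have hχT : χ T = 0 := image_eq_zero_of_notMem_tsupport fun h => (hU h).2.ne rfl
    have hχz : χ 0 = 0 := image_eq_zero_of_notMem_tsupport fun h => (hU h).1.ne rfl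
    have hU' : tsupport (deriv χ) ⊆ Ioo 0 T := (tsupport_deriv_subset (f := χ)).trans hU
    have hχ' : Continuous (deriv χ) := (contDiff_infty_iff_deriv.mp hχ).2.continuous
    have I1 := hu.tensor_identity hu₀ hf hθ2 hc hθ0 hζ hζc hζ0 (hBd.of_le hinf)
      B.hasCompactSupport hB0 hBT (hχ.of_le hinf) hχc hχ0 hχT
    have I2 := hu.tensor_identity hu₀ hf hθ2 hc hθ0 hζ hζc hζ0 (hBd.of_le hinf)
      B.hasCompactSupport hB0 hBT (χ₂ := fun _ => 0) contDiff_const hz0 (fun _ => le_rfl) rfl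
    have n1 : ¬ IntegrableOn (fun t => B t * spaceIntegral (fun z => |u z| ^ p) θ t
        + χ t * spaceIntegral (fun z => |u z| ^ p) ζ t) (Ioo 0 T) := fun h => hA (by
      have h' := Integrable.sub h (tens hχ.continuous hχc hU hupl hζ.continuous hζc).integrableOn
      refine Integrable.congr h' (.of_forall fun t => ?_)
      simp)
    rw [integral_undef n1, integral_add hdB
      (tens hχ' hχc.deriv hU' hul hζ.continuous hζc).integrableOn, whole' hU, whole hU', hχz] at I1
    simp only [zero_mul, add_zero, deriv_const, integral_zero] at I2
    rw [integral_undef hA] at I2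
    linarith
  by_cases hl : IntegrableOn (fun t => B t * spaceIntegral u (subLaplacian θ) t) (Ioo 0 T)
  · -- the weak formulation forces the source to vanish
    have hz : ∀ᵐ t : ℝ, t ∈ Ioo 0 T → spaceIntegral (fun z => |u z| ^ p) θ t = 0 := by
      refine isOpen_Ioo.ae_eq_zero_of_integral_contDiff_smul_eq_zero
        (locallyIntegrableOn_spaceIntegral hupl hθ.continuous hc) fun χ hχ hχc hU => ?_
      have hg0 : LocallyIntegrableOn (fun _ : ℝ => (0 : ℝ)) (Ioo 0 T) :=
        continuous_const.locallyIntegrable.locallyIntegrableOn _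
      have := integral_testing_eq_zero_of_nonneg hT
        (locallyIntegrableOn_spaceIntegral hupl hθ.continuous hc) hg0 (fun ξ hξ hξc hξU hξ0 => ?_)
        hχ hχc hU
      · simpa using this
      have hξT : ξ T = 0 := image_eq_zero_of_notMem_tsupport fun h => (hξU h).2.ne rfl
      have hξz : ξ 0 = 0 := image_eq_zero_of_notMem_tsupport fun h => (hξU h).1.ne rfl
      have hU' : tsupport (deriv ξ) ⊆ Ioo 0 T := (tsupport_deriv_subset (f := ξ)).trans hξU
      have D := diff hξ hξc hξU hξ0 hθ2 hc hθ0
      rw [integral_add hl (tens hξ.continuous hξc hξU hul hL2.continuous hLc).integrableOn,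
        whole hξU] at D
      have I := hu.tensor_identity hu₀ hf hθ2 hc hθ0 hθ2 hc hθ0 (hξ.of_le hinf) hξc hξ0 hξT
        (χ₂ := fun _ => 0) contDiff_const hz0 (fun _ => le_rfl) rfl
      simp only [zero_mul, add_zero, deriv_const, integral_zero, hξz, mul_zero] at I ⊢
      rw [whole hξU, whole hξU, whole hU', whole' hξU] at I
      linarith
    refine hnot ((integrableOn_zero (μ := volume) (s := Ioo 0 b)).congr_fun_ae ?_)
    rw [Filter.EventuallyEq, ae_restrict_iff' measurableSet_Ioo]
    filter_upwards [hz] with t ht hm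
    exact (ht ⟨hm.1, hm.2.trans hbT⟩).symm
  · -- every spatial average of `u` has a constant weak derivative
    have hm {ζ : Heis N → ℝ} (hζ : ContDiff ℝ 2 ζ) (hζc : HasCompactSupport ζ)
        (hζ0 : ∀ η, 0 ≤ ζ η) : IntegrableOn (spaceIntegral u ζ) (Ioo 0 T) := by
      refine integrableOn_of_weak_deriv_const hT
        (locallyIntegrableOn_spaceIntegral hul hζ.continuous hζc) (∫ η, f η * ζ η)
        fun χ hχ hχc hU hχ0 => ?_
      have hU' : tsupport (deriv χ) ⊆ Ioo 0 T := (tsupport_deriv_subset (f := χ)).trans hU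
      have hχ' : Continuous (deriv χ) := (contDiff_infty_iff_deriv.mp hχ).2.continuous
      have D := diff hχ hχc hU hχ0 hζ hζc hζ0
      have n1 : ¬ IntegrableOn (fun t => B t * spaceIntegral u (subLaplacian θ) t
          + χ t * spaceIntegral u (subLaplacian ζ) t) (Ioo 0 T) := fun h => hl (by
        have h' := Integrable.sub h (tens hχ.continuous hχc hU hul
          (contDiff_subLaplacian hζ (m := 0) (by norm_num)).continuous
          (hasCompactSupport_subLaplacian hζ hζc)).integrableOn
        refine Integrable.congr h' (.of_forall fun t => ?_)
        simp)
      rw [integral_undef n1, integral_undef hl] at D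
      rw [integral_add ((hχ.continuous.integrable_of_hasCompactSupport hχc).mul_const _)
        (tens hχ' hχc.deriv hU' hul hζ.continuous hζc), integral_mul_const]
      linarith
    obtain ⟨ρ, hρ, hρc, hρ0, hρ1⟩ := exists_space_cutoff hc
    have hρ2 : ContDiff ℝ 2 ρ := hρ.of_le hinf
    obtain ⟨C, hC⟩ := hLc.exists_bound_of_continuous hL2.continuous
    have hC0 : 0 ≤ C := (norm_nonneg _).trans (hC 0)
    have h1 := hm (hL2.add (contDiff_const.mul hρ2)) (hLc.add (hρc.mul_left (f := fun _ => C)))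
      fun η => by
        by_cases hη : η ∈ tsupport θ
        · rw [hρ1 η hη, mul_one]
          linarith [neg_le_of_abs_le (hC η)]
        · rw [subLaplacian_eq_zero_of_notMem_tsupport hθ2 hη, zero_add]
          exact mul_nonneg hC0 (hρ0 η)
    have h2 := hm hρ2 hρc hρ0
    have h3 : IntegrableOn (spaceIntegral u (subLaplacian θ)) (Ioo 0 T) := by
      refine Integrable.congr (h1.sub (h2.const_mul C)) ?_
      filter_upwards [ae_spaceIntegral_add_mul hul hL2.continuous hLc hρ.continuous hρc
        (fun _ => 1) (fun _ => C)] with t ht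
      simp only [one_mul] at ht
      simp only [Pi.sub_apply, ht]
      ring
    exact hl (Integrable.bdd_mul (c := 1) h3 hBd.continuous.aestronglyMeasurable
      (.of_forall fun t => by rw [Real.norm_of_nonneg (hB0 t)]; exact B.le_one))

/-- The source is integrable up to the initial time, locally in space. -/
lemma IsWeakSol.integrableOn_source_mul (hu : IsWeakSol N p T u₀ f u) (hT : 0 < T)
    (hu₀ : LocallyIntegrable u₀) (hf : LocallyIntegrable f) {θ : Heis N → ℝ}
    (hθ : ContDiff ℝ 4 θ) (hc : HasCompactSupport θ) (hθ0 : ∀ η, 0 ≤ θ η)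
    {b : ℝ} (hb : 0 < b) (hbT : b < T) :
    IntegrableOn (fun z => |u z| ^ p * θ z.2) (Ioo 0 b ×ˢ univ) := by
  obtain ⟨-, hupl, -⟩ := id hu
  have hsub : Ioo (0 : ℝ) b ×ˢ (univ : Set (Heis N)) ⊆ Ioo 0 T ×ˢ univ :=
    prod_mono (Ioo_subset_Ioo_right hbT.le) le_rfl
  rw [IntegrableOn, volume_restrict_prod_univ, integrable_prod_iff]
  · refine ⟨ae_mono (Measure.restrict_mono (Ioo_subset_Ioo_right hbT.le) le_rfl)
      (ae_integrable_slice hupl hθ.continuous hc), ?_⟩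
    refine (hu.integrableOn_spaceIntegral_source hT hu₀ hf hθ hc hθ0 hb hbT).congr
      (.of_forall fun t => integral_congr_ae (.of_forall fun η => ?_))
    exact (Real.norm_of_nonneg (mul_nonneg (rpow_nonneg (abs_nonneg _) _) (hθ0 η))).symm
  · rw [← volume_restrict_prod_univ]
    exact ((hupl.mono_set hsub).aestronglyMeasurable).mul
      (hθ.continuous.comp continuous_snd).aestronglyMeasurable

end NearInitialTime

section Young

/-- The constant in Young's inequality `x d ≤ κ x ^ p + C d ^ p'`. -/
def youngConst (p κ : ℝ) : ℝ := (1 / (p / (p - 1))) * (1 / (κ * p)) ^ (p / (p - 1) - 1)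

lemma youngConst_nonneg {p κ : ℝ} (hp : 1 < p) (hκ : 0 ≤ κ) : 0 ≤ youngConst p κ := by
  have : 0 < p - 1 := by linarith
  unfold youngConst
  positivity

lemma mul_le_weighted_young {p κ x s d : ℝ} (hp : 1 < p) (hκ : 0 < κ) (hx : 0 ≤ x) (hs : 0 < s)
    (hd : 0 ≤ d) :
    x * d ≤ κ * (x ^ p * s) + youngConst p κ * (s ^ (-(1 / (p - 1))) * d ^ (p / (p - 1))) := by
  have hp0 : 0 < p := by linarith
  have hp1 : 0 < p - 1 := by linarith
  have hc : 0 < κ * p * s := by positivity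
  have hr : 0 < (κ * p * s) ^ (1 / p) := rpow_pos_of_pos hc _
  have hpq : p.HolderConjugate (p / (p - 1)) := .conjExponent hp
  have h := Real.young_inequality_of_nonneg (mul_nonneg hx hr.le) (div_nonneg hd hr.le) hpq
  have e0 : x * (κ * p * s) ^ (1 / p) * (d / (κ * p * s) ^ (1 / p)) = x * d := by
    field_simp
  have e1 : (x * (κ * p * s) ^ (1 / p)) ^ p / p = κ * (x ^ p * s) := by
    rw [mul_rpow hx hr.le, ← rpow_mul hc.le, one_div_mul_cancel hp0.ne', rpow_one]
    field_simp
  have e2 : (d / (κ * p * s) ^ (1 / p)) ^ (p / (p - 1)) / (p / (p - 1))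
      = youngConst p κ * (s ^ (-(1 / (p - 1))) * d ^ (p / (p - 1))) := by
    have hexp : 1 / p * (p / (p - 1)) = 1 / (p - 1) := by field_simp
    have hexp' : p / (p - 1) - 1 = 1 / (p - 1) := by field_simp; ring
    rw [div_rpow hd hr.le, ← rpow_mul hc.le, hexp, youngConst, hexp', mul_rpow (by positivity) hs.le,
      rpow_neg hs.le, one_div (κ * p), inv_rpow (by positivity)]
    field_simp
  rwa [e0, e1, e2] at h

end Young

section Estimate

variable {N : ℕ} {T p : ℝ} {u₀ f : Heis N → ℝ} {u : ℝ × Heis N → ℝ} {ψ : ℝ × Heis N → ℝ}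

/-- The capacity density `ψ ^ (-1/(p-1)) |g| ^ (p/(p-1))`, extended by zero off `{ψ > 0}`. -/
def capDensity (p : ℝ) (ψ g : ℝ × Heis N → ℝ) : ℝ × Heis N → ℝ :=
  indicator {z | 0 < ψ z} fun z => ψ z ^ (-(1 / (p - 1))) * |g z| ^ (p / (p - 1))

lemma capDensity_nonneg (hψ : ∀ z, 0 ≤ ψ z) (g : ℝ × Heis N → ℝ) (z : ℝ × Heis N) :
    0 ≤ capDensity p ψ g z :=
  indicator_nonneg (fun z _ => mul_nonneg (rpow_nonneg (hψ z) _) (rpow_nonneg (abs_nonneg _) _)) z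

lemma mul_le_young_capDensity {κ x : ℝ} (hp : 1 < p) (hκ : 0 < κ) (hx : 0 ≤ x)
    (hψ : ∀ z, 0 ≤ ψ z) {g : ℝ × Heis N → ℝ} {z : ℝ × Heis N} (hg : ψ z = 0 → g z = 0) :
    x * |g z| ≤ κ * (x ^ p * ψ z) + youngConst p κ * capDensity p ψ g z := by
  rcases (hψ z).eq_or_lt' with h | h
  · rw [hg h, h, abs_zero, mul_zero, mul_zero, mul_zero, zero_add]
    exact mul_nonneg (youngConst_nonneg hp hκ.le) (capDensity_nonneg hψ _ _)
  · rw [capDensity, indicator_of_mem (show z ∈ {z | 0 < ψ z} from h)]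
    exact mul_le_weighted_young hp hκ hx h (abs_nonneg _)

/-- The weak formulation as an inequality, when the terms involving `u` are dominated. -/
lemma IsWeakSol.integral_source_add_le (hu : IsWeakSol N p T u₀ f u) (hu₀0 : ∀ η, 0 ≤ u₀ η)
    (hψ : IsTestFun N T ψ)
    (hA : IntegrableOn (fun z => |u z| ^ p * ψ z) (Ioo 0 T ×ˢ univ))
    {B₁ B₂ : ℝ × Heis N → ℝ} (h₁ : IntegrableOn B₁ (Ioo 0 T ×ˢ univ))
    (h₂ : IntegrableOn B₂ (Ioo 0 T ×ˢ univ))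
    (hb₁ : ∀ᵐ z, |u z * dirDeriv (1, 0) ψ z| ≤ B₁ z)
    (hb₂ : ∀ᵐ z, |u z * slicedSubLaplacian ψ z| ≤ B₂ z) :
    (∫ z in Ioo 0 T ×ˢ univ, |u z| ^ p * ψ z) + (∫ t in Ioo 0 T, ∫ η, f η * ψ (t, η))
      ≤ (∫ z in Ioo 0 T ×ˢ univ, B₁ z) + ∫ z in Ioo 0 T ×ˢ univ, B₂ z := by
  obtain ⟨hul, -, hweak⟩ := hu
  have key := hweak ψ hψ
  obtain ⟨hψ2, -, hψ0, -⟩ := hψ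
  have ht (t : ℝ) (η : Heis N) : deriv (fun s => ψ (s, η)) t = dirDeriv (1, 0) ψ (t, η) :=
    deriv_time_eq (hψ2.differentiable two_ne_zero) (t, η)
  have hL (t : ℝ) (η : Heis N) :
      subLaplacian (fun ξ => ψ (t, ξ)) η = slicedSubLaplacian ψ (t, η) :=
    subLaplacian_slice hψ2 (t, η)
  simp only [ht, hL] at key
  have hm : AEStronglyMeasurable u (volume.restrict (Ioo (0 : ℝ) T ×ˢ (univ : Set (Heis N)))) :=
    hul.aestronglyMeasurable
  have dom {g B : ℝ × Heis N → ℝ} (hg : Continuous g) (hB : IntegrableOn B (Ioo 0 T ×ˢ univ))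
      (hb : ∀ᵐ z, |u z * g z| ≤ B z) :
      -(∫ t in Ioo 0 T, ∫ η, u (t, η) * g (t, η)) ≤ ∫ z in Ioo 0 T ×ˢ univ, B z := by
    have hi : IntegrableOn (fun z => u z * g z) (Ioo 0 T ×ˢ univ) :=
      Integrable.mono' hB (hm.mul hg.aestronglyMeasurable) (ae_restrict_of_ae hb)
    have e : ∫ t in Ioo 0 T, ∫ η, u (t, η) * g (t, η) = ∫ z in Ioo 0 T ×ˢ univ, u z * g z := by
      rw [IntegrableOn, volume_restrict_prod_univ] at hi
      rw [volume_restrict_prod_univ, integral_prod _ hi]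
    rw [e, ← integral_neg]
    refine integral_mono_ae hi.neg hB ?_
    filter_upwards [ae_restrict_of_ae hb] with z hz
    exact (neg_le_abs _).trans hz
  have d₁ := dom (hψ2.dirDeriv (m := 0) (by norm_num) (1, 0)).continuous h₁ hb₁
  have d₂ := dom (hψ2.slicedSubLaplacian (m := 0) (by norm_num)).continuous h₂ hb₂
  have eA : ∫ t in Ioo 0 T, ∫ η, |u (t, η)| ^ p * ψ (t, η)
      = ∫ z in Ioo 0 T ×ˢ univ, |u z| ^ p * ψ z := by
    rw [IntegrableOn, volume_restrict_prod_univ] at hA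
    rw [volume_restrict_prod_univ, integral_prod _ hA]
  have hU : 0 ≤ ∫ η, u₀ η * ψ (0, η) := integral_nonneg fun η => mul_nonneg (hu₀0 η) (hψ0 _)
  rw [eA] at key
  linarith

end Estimate

section Cutoff

open scoped ContDiff

/-- A smooth step whose derivative is controlled by a power of the step itself. -/
lemma exists_smooth_step_deriv_le_rpow {p : ℝ} (hp : 1 < p) :
    ∃ g : ℝ → ℝ, ∃ D : ℝ, ContDiff ℝ ∞ g ∧ 0 ≤ D ∧ (∀ s, 0 ≤ g s) ∧ (∀ s, g s ≤ 1) ∧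
      (∀ s ≤ 0, g s = 0) ∧ (∀ s, 1 ≤ s → g s = 1) ∧ ∀ s, |deriv g s| ≤ D * g s ^ (1 / p) := by
  have hp0 : 0 < p := by linarith
  have hp1 : 0 < p - 1 := by linarith
  have hst : ContDiff ℝ ∞ smoothTransition := smoothTransition.contDiff
  have hd : HasCompactSupport (deriv smoothTransition) := by
    refine HasCompactSupport.intro (isCompact_Icc (a := (0 : ℝ)) (b := 1)) fun s hs => ?_
    rw [mem_Icc, not_and_or, not_le, not_le] at hs
    rcases hs with hs | hs
    · have : smoothTransition =ᶠ[nhds s] fun _ => (0 : ℝ) := by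
        filter_upwards [Iio_mem_nhds hs] with t ht
        exact smoothTransition.zero_of_nonpos (le_of_lt ht)
      rw [this.deriv_eq, deriv_const]
    · have : smoothTransition =ᶠ[nhds s] fun _ => (1 : ℝ) := by
        filter_upwards [Ioi_mem_nhds hs] with t ht
        exact smoothTransition.one_of_one_le (le_of_lt ht)
      rw [this.deriv_eq, deriv_const]
  obtain ⟨D, hD⟩ := hd.exists_bound_of_continuous (contDiff_infty_iff_deriv.mp hst).2.continuous
  have hD0 : 0 ≤ D := (norm_nonneg _).trans (hD 0)
  obtain ⟨m, hm⟩ := exists_nat_ge (p / (p - 1))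
  refine ⟨fun s => smoothTransition s ^ (m + 2), (m + 2) * D, hst.pow _, by positivity,
    fun s => pow_nonneg (smoothTransition.nonneg s) _,
    fun s => pow_le_one₀ (smoothTransition.nonneg s) (smoothTransition.le_one s),
    fun s hs => by simp [smoothTransition.zero_of_nonpos hs],
    fun s hs => by simp [smoothTransition.one_of_one_le hs], fun s => ?_⟩
  have h0 := smoothTransition.nonneg s
  have hderiv : deriv (fun s => smoothTransition s ^ (m + 2)) s
      = (m + 2) * smoothTransition s ^ (m + 1) * deriv smoothTransition s := by
    have := ((hst.differentiable (by simp) s).hasDerivAt.fun_pow (m + 2)).deriv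
    simpa using this
  have hpow : smoothTransition s ^ (m + 1) ≤ (smoothTransition s ^ (m + 2)) ^ (1 / p) := by
    rcases h0.eq_or_lt with h | h
    · rw [← h]
      simp [(rpow_nonneg (le_refl (0 : ℝ)) _)]
    · rw [← rpow_natCast, ← rpow_natCast, ← rpow_mul h0]
      refine rpow_le_rpow_of_exponent_ge h (smoothTransition.le_one s) ?_
      rw [div_le_iff₀ hp1] at hm
      push_cast
      rw [mul_one_div, div_le_iff₀ hp0]
      nlinarith
  have hD' := hD s
  rw [Real.norm_eq_abs] at hD'
  have hpow0 := pow_nonneg h0 (m + 1)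
  rw [hderiv, abs_mul, abs_mul, abs_of_nonneg hpow0, abs_of_nonneg (by positivity : (0 : ℝ) ≤ m + 2)]
  calc (m + 2) * smoothTransition s ^ (m + 1) * |deriv smoothTransition s|
      ≤ (m + 2) * (smoothTransition s ^ (m + 2)) ^ (1 / p) * D := by gcongr
    _ = _ := by ring

lemma exists_terminal_cutoff {p : ℝ} (hp : 1 < p) :
    ∃ D : ℝ, 0 ≤ D ∧ ∀ T ε : ℝ, 0 < ε → ∃ χ : ℝ → ℝ, ContDiff ℝ ∞ χ ∧ (∀ t, 0 ≤ χ t) ∧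
      (∀ t, χ t ≤ 1) ∧ (∀ t, T - ε ≤ t → χ t = 0) ∧ (∀ t ≤ T - 2 * ε, χ t = 1) ∧
      (∀ t, |deriv χ t| ≤ D / ε * χ t ^ (1 / p)) ∧
      ∀ t ∉ Icc (T - 2 * ε) T, deriv χ t = 0 := by
  obtain ⟨g, D, hg, hD, hg0, hg1, hgz, hgo, hgd⟩ := exists_smooth_step_deriv_le_rpow hp
  refine ⟨D, hD, fun T ε hε => ?_⟩
  have hzero (t : ℝ) (ht : T - ε ≤ t) : g ((T - t) / ε - 1) = 0 :=
    hgz _ (by rw [sub_nonpos, div_le_one hε]; linarith)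
  have hone (t : ℝ) (ht : t ≤ T - 2 * ε) : g ((T - t) / ε - 1) = 1 :=
    hgo _ (by rw [le_sub_iff_add_le, le_div_iff₀ hε]; linarith)
  refine ⟨fun t => g ((T - t) / ε - 1), ?_, fun _ => hg0 _, fun _ => hg1 _, hzero, hone,
    fun t => ?_, fun t ht => ?_⟩
  · exact hg.comp (by fun_prop)
  · have h1 : HasDerivAt (fun t => (T - t) / ε - 1) (-1 / ε) t :=
      (((hasDerivAt_id t).const_sub T).div_const ε).sub_const 1
    have h2 := ((hg.differentiable (by simp) ((T - t) / ε - 1)).hasDerivAt.comp t h1).deriv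
    have h3 : deriv (fun t => g ((T - t) / ε - 1)) t = deriv g ((T - t) / ε - 1) * (-1 / ε) := h2
    rw [h3, abs_mul, abs_div, abs_neg, abs_one, abs_of_pos hε, mul_one_div, div_mul_eq_mul_div]
    exact div_le_div_of_nonneg_right (hgd _) hε.le
  · rw [mem_Icc, not_and_or, not_le, not_le] at ht
    rcases ht with ht | ht
    · have : (fun t => g ((T - t) / ε - 1)) =ᶠ[nhds t] fun _ => (1 : ℝ) := by
        filter_upwards [Iio_mem_nhds ht] with s hs
        exact hone s (le_of_lt hs)
      rw [this.deriv_eq, deriv_const]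
    · have : (fun t => g ((T - t) / ε - 1)) =ᶠ[nhds t] fun _ => (0 : ℝ) := by
        filter_upwards [Ioi_mem_nhds ht] with s hs
        exact hzero s (by linarith [mem_Ioi.mp hs])
      rw [this.deriv_eq, deriv_const]

end Cutoff

section TerminalLayer

variable {N : ℕ} {T p : ℝ} {ψ : ℝ × Heis N → ℝ}

/-- A test function vanishing at the terminal time has small mass near that time, with a rate
dictated by its temporal capacity. -/
lemma IsTestFun.setIntegral_terminal_layer_le (hψ : IsTestFun N T ψ) (hp : 1 < p)
    (hK : Integrable (capDensity p ψ (dirDeriv (1, 0) ψ))) {ε : ℝ} (hε : 0 < ε) :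
    ∫ z in Icc (T - 2 * ε) T ×ˢ univ, ψ z
      ≤ 4 * youngConst p (1 / 4) * ε ^ (p / (p - 1)) * ∫ z, capDensity p ψ (dirDeriv (1, 0) ψ) z := by
  obtain ⟨hψ2, hψc, hψ0, hψT⟩ := hψ
  have hp1 : 0 < p - 1 := by linarith
  have hp0 : 0 < p := by linarith
  have hd : Differentiable ℝ ψ := hψ2.differentiable two_ne_zero
  have hgc : Continuous (dirDeriv (1, 0) ψ) := (hψ2.dirDeriv (m := 0) (by norm_num) (1, 0)).continuous
  have hgs : HasCompactSupport (dirDeriv (1, 0) ψ) :=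
    HasCompactSupport.intro hψc fun _ hz => dirDeriv_eq_zero_of_notMem_tsupport hz _
  have iψ : Integrable ψ := hψ2.continuous.integrable_of_hasCompactSupport hψc
  have ig : Integrable fun z => |dirDeriv (1, 0) ψ z| :=
    (hgc.integrable_of_hasCompactSupport hgs).abs
  set L : Set (ℝ × Heis N) := Icc (T - 2 * ε) T ×ˢ univ with hL
  set E : ℝ := ∫ z in L, |dirDeriv (1, 0) ψ z| with hE
  set σ : ℝ := ∫ z in L, ψ z with hσ
  have iψ' : Integrable ψ ((volume.restrict (Icc (T - 2 * ε) T)).prod volume) := by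
    rw [← volume_restrict_prod_univ]; exact iψ.integrableOn
  have ig' : Integrable (fun z => |dirDeriv (1, 0) ψ z|)
      ((volume.restrict (Icc (T - 2 * ε) T)).prod volume) := by
    rw [← volume_restrict_prod_univ]; exact ig.integrableOn
  have h1 : σ ≤ 2 * ε * E := by
    have hslice : ∀ t ∈ Icc (T - 2 * ε) T, ∫ η, ψ (t, η) ≤ E := by
      intro t ht
      rw [hE, hL, volume_restrict_prod_univ, integral_prod_symm _ ig']
      refine integral_mono_of_nonneg (.of_forall fun η => hψ0 _) ig'.integral_prod_right
        (.of_forall fun η => ?_)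
      have hc : Continuous fun s : ℝ => dirDeriv (1, 0) ψ (s, η) := hgc.comp (by fun_prop)
      have hftc : ∫ s in t..T, dirDeriv (1, 0) ψ (s, η) = ψ (T, η) - ψ (t, η) := by
        refine intervalIntegral.integral_eq_sub_of_hasDerivAt (f := fun s => ψ (s, η))
          (fun s _ => ?_)
          (hc.intervalIntegrable _ _)
        have := deriv_time_eq hd (s, η)
        rw [← this]
        refine DifferentiableAt.hasDerivAt ?_
        exact (hd (s, η)).comp s (by fun_prop : DifferentiableAt ℝ (fun s : ℝ => (s, η)) s)
      have hb : ψ (t, η) = - ∫ s in t..T, dirDeriv (1, 0) ψ (s, η) := by rw [hftc, hψT]; ring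
      have iIcc : IntegrableOn (fun s : ℝ => |dirDeriv (1, 0) ψ (s, η)|) (Icc (T - 2 * ε) T) :=
        hc.abs.integrableOn_Icc
      simp only
      calc ψ (t, η) ≤ |∫ s in t..T, dirDeriv (1, 0) ψ (s, η)| := by rw [hb]; exact neg_le_abs _
        _ ≤ ∫ s in t..T, |dirDeriv (1, 0) ψ (s, η)| :=
          intervalIntegral.abs_integral_le_integral_abs ht.2
        _ = ∫ s in Ioc t T, |dirDeriv (1, 0) ψ (s, η)| := intervalIntegral.integral_of_le ht.2
        _ ≤ _ := setIntegral_mono_set iIcc (.of_forall fun _ => abs_nonneg _)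
          (.of_forall fun s hs => ⟨ht.1.trans hs.1.le, hs.2⟩)
    have hvol : volume.real (Icc (T - 2 * ε) T) = 2 * ε := by
      rw [volume_real_Icc_of_le (by linarith)]; ring
    rw [hσ, hL, volume_restrict_prod_univ, integral_prod _ iψ']
    calc ∫ t in Icc (T - 2 * ε) T, ∫ η, ψ (t, η) ≤ ∫ _ in Icc (T - 2 * ε) T, E :=
          setIntegral_mono_on iψ'.integral_prod_left (integrableOn_const measure_Icc_lt_top.ne)
            measurableSet_Icc hslice
      _ = 2 * ε * E := by rw [setIntegral_const, hvol, smul_eq_mul]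
  have h2 : E ≤ 1 / 4 / ε * σ + youngConst p (1 / 4) * ε ^ (1 / (p - 1)) *
      ∫ z, capDensity p ψ (dirDeriv (1, 0) ψ) z := by
    set k := capDensity p ψ (dirDeriv (1, 0) ψ) with hk
    have hpt : ∀ᵐ z, |dirDeriv (1, 0) ψ z|
        ≤ 1 / 4 / ε * ψ z + youngConst p (1 / 4) * ε ^ (1 / (p - 1)) * k z := by
      filter_upwards [ae_dirDeriv_eq_zero volume (hψ2.of_le one_le_two) ((1, 0) : ℝ × Heis N)]
        with z hz
      have hx : 0 < ε ^ (-(1 / (p - 1))) := rpow_pos_of_pos hε _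
      have hy := mul_le_young_capDensity hp (κ := 1 / 4) (by norm_num) hx.le hψ0 hz
      have hxp : (ε ^ (-(1 / (p - 1)))) ^ p = ε⁻¹ * ε ^ (-(1 / (p - 1))) := by
        rw [← rpow_mul hε.le, ← rpow_neg_one, ← rpow_add hε]
        congr 1
        field_simp
        ring
      rw [hxp] at hy
      have hinv : ε ^ (1 / (p - 1)) * ε ^ (-(1 / (p - 1))) = 1 := by
        rw [← rpow_add hε, add_neg_cancel, rpow_zero]
      calc |dirDeriv (1, 0) ψ z|
          = ε ^ (1 / (p - 1)) * (ε ^ (-(1 / (p - 1))) * |dirDeriv (1, 0) ψ z|) := by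
            rw [← mul_assoc, hinv, one_mul]
        _ ≤ ε ^ (1 / (p - 1)) * (1 / 4 * (ε⁻¹ * ε ^ (-(1 / (p - 1))) * ψ z)
            + youngConst p (1 / 4) * k z) := by gcongr
        _ = ε ^ (1 / (p - 1)) * ε ^ (-(1 / (p - 1))) * (1 / 4 / ε * ψ z)
            + youngConst p (1 / 4) * ε ^ (1 / (p - 1)) * k z := by ring
        _ = _ := by rw [hinv, one_mul]
    have iK : IntegrableOn k L := hK.integrableOn
    calc E ≤ ∫ z in L, (1 / 4 / ε * ψ z + youngConst p (1 / 4) * ε ^ (1 / (p - 1)) * k z) :=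
          integral_mono_ae ig.integrableOn
            ((iψ.integrableOn.const_mul _).add (iK.const_mul _)) (ae_restrict_of_ae hpt)
      _ = 1 / 4 / ε * σ + youngConst p (1 / 4) * ε ^ (1 / (p - 1)) * ∫ z in L, k z := by
          rw [integral_add (iψ.integrableOn.const_mul _) (iK.const_mul _), integral_const_mul,
            integral_const_mul]
      _ ≤ _ := by
          have := youngConst_nonneg hp (κ := 1 / 4) (by norm_num)
          have := setIntegral_le_integral (s := L) hK (.of_forall (capDensity_nonneg hψ0 _))
          gcongr
  have he : ε ^ (p / (p - 1)) = ε * ε ^ (1 / (p - 1)) := by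
    conv_rhs => rw [← rpow_one ε, ← rpow_mul hε.le, one_mul, ← rpow_add hε]
    congr 1
    field_simp
    ring
  rw [he]
  have h3 := mul_le_mul_of_nonneg_left h2 (by linarith : (0 : ℝ) ≤ 2 * ε)
  have h4 : 2 * ε * (1 / 4 / ε * σ + youngConst p (1 / 4) * ε ^ (1 / (p - 1)) *
      ∫ z, capDensity p ψ (dirDeriv (1, 0) ψ) z) = σ / 2 + 2 * (youngConst p (1 / 4) *
      (ε * ε ^ (1 / (p - 1))) * ∫ z, capDensity p ψ (dirDeriv (1, 0) ψ) z) := by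
    field_simp
    ring
  linarith

end TerminalLayer

section Integrability

open scoped ContDiff

variable {N : ℕ} {T p : ℝ} {u₀ f : Heis N → ℝ} {u : ℝ × Heis N → ℝ} {ψ : ℝ × Heis N → ℝ}

lemma IsTestFun.exists_space_majorant (hψ : IsTestFun N T ψ) :
    ∃ θ : Heis N → ℝ, ContDiff ℝ ∞ θ ∧ HasCompactSupport θ ∧ (∀ η, 0 ≤ θ η) ∧
      ∀ z, ψ z ≤ θ z.2 := by
  obtain ⟨hψ2, hψc, hψ0, -⟩ := hψ
  obtain ⟨ρ, hρ, hρc, hρ0, hρ1⟩ := exists_space_cutoff (hψc.isCompact.image continuous_snd)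
  obtain ⟨M, hM⟩ := hψc.exists_bound_of_continuous hψ2.continuous
  have hM0 : 0 ≤ M := (norm_nonneg _).trans (hM 0)
  refine ⟨fun η => M * ρ η, contDiff_const.mul hρ, hρc.mul_left,
    fun η => mul_nonneg hM0 (hρ0 η), fun z => ?_⟩
  by_cases hz : z ∈ tsupport ψ
  · simp only [hρ1 z.2 ⟨z, hz, rfl⟩, mul_one]
    exact (le_abs_self _).trans (hM z)
  · rw [image_eq_zero_of_notMem_tsupport hz]
    exact mul_nonneg hM0 (hρ0 _)

lemma IsWeakSol.integrableOn_source_mul_test (hu : IsWeakSol N p T u₀ f u) (hT : 0 < T)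
    (hu₀ : LocallyIntegrable u₀) (hf : LocallyIntegrable f) (hψ : IsTestFun N T ψ)
    {b : ℝ} (hb : 0 < b) (hbT : b < T) :
    IntegrableOn (fun z => |u z| ^ p * ψ z) (Ioo 0 b ×ˢ univ) := by
  obtain ⟨θ, hθ, hθc, hθ0, hψθ⟩ := hψ.exists_space_majorant
  have hsub : Ioo (0 : ℝ) b ×ˢ (univ : Set (Heis N)) ⊆ Ioo 0 T ×ˢ univ :=
    prod_mono (Ioo_subset_Ioo_right hbT.le) le_rfl
  refine Integrable.mono'
    (hu.integrableOn_source_mul hT hu₀ hf (hθ.of_le ENat.LEInfty.out) hθc hθ0 hb hbT)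
    ((hu.2.1.mono_set hsub).aestronglyMeasurable.mul hψ.1.continuous.aestronglyMeasurable)
    (.of_forall fun z => ?_)
  have := rpow_nonneg (abs_nonneg (u z)) p
  rw [Real.norm_of_nonneg (mul_nonneg this (hψ.2.2.1 z))]
  exact mul_le_mul_of_nonneg_left (hψθ z) this

lemma abs_integral_forcing_le {g θ : Heis N → ℝ} (hT : 0 < T) (hg : Integrable fun η => g η * θ η)
    {φ : ℝ × Heis N → ℝ} (hφ0 : ∀ z, 0 ≤ φ z) (hφ : ∀ z, φ z ≤ θ z.2) :
    |∫ t in Ioo 0 T, ∫ η, g η * φ (t, η)| ≤ (∫ η, |g η * θ η|) * T := by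
  have h := norm_setIntegral_le_of_norm_le_const (μ := volume) (s := Ioo 0 T)
    (f := fun t => ∫ η, g η * φ (t, η)) (C := ∫ η, |g η * θ η|) measure_Ioo_lt_top fun t _ =>
      norm_integral_le_of_norm_le hg.abs (.of_forall fun η => by
        rw [Real.norm_eq_abs, abs_mul, abs_mul, abs_of_nonneg (hφ0 _),
          abs_of_nonneg ((hφ0 (t, η)).trans (hφ _))]
        exact mul_le_mul_of_nonneg_left (hφ _) (abs_nonneg _))
  rwa [Real.norm_eq_abs, volume_real_Ioo_of_le hT.le, sub_zero] at h

/-- Away from the terminal time, the source paired with a test function of finite capacity is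
bounded uniformly. -/
lemma IsWeakSol.exists_bound_source_mul_test (hu : IsWeakSol N p T u₀ f u) (hp : 1 < p)
    (hT : 0 < T) (hu₀ : LocallyIntegrable u₀) (hu₀0 : ∀ η, 0 ≤ u₀ η) (hf : LocallyIntegrable f)
    (hψ : IsTestFun N T ψ) (hK₁ : Integrable (capDensity p ψ (dirDeriv (1, 0) ψ)))
    (hK₂ : Integrable (capDensity p ψ (slicedSubLaplacian ψ))) :
    ∃ M : ℝ, ∀ ε : ℝ, 0 < ε → 2 * ε < T →
      ∫ z in Ioo 0 (T - 2 * ε) ×ˢ univ, |u z| ^ p * ψ z ≤ M := by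
  obtain ⟨D, hD, hcut⟩ := exists_terminal_cutoff hp
  obtain ⟨θ, hθ, hθc, hθ0, hψθ⟩ := hψ.exists_space_majorant
  have hfθ : Integrable fun η => f η * θ η :=
    hf.integrable_smul_right_of_hasCompactSupport hθ.continuous hθc
  obtain ⟨hψ2, hψc, hψ0, hψT⟩ := id hψ
  set k₁ := capDensity p ψ (dirDeriv (1, 0) ψ) with hk₁
  set k₂ := capDensity p ψ (slicedSubLaplacian ψ) with hk₂
  set C := youngConst p (1 / 6) with hC
  have hC0 : 0 ≤ C := youngConst_nonneg hp (by norm_num)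
  have hp0 : 0 < p := by linarith
  have hp1 : 0 < p - 1 := by linarith
  refine ⟨2 * ((∫ η, |f η * θ η|) * T + C * (∫ z, k₁ z) + C * (∫ z, k₂ z)
    + C * (D ^ (p / (p - 1)) * (4 * youngConst p (1 / 4) * ∫ z, k₁ z))), fun ε hε hεT => ?_⟩
  obtain ⟨χ, hχ, hχ0, hχ1, hχz, hχo, hχd, hχs⟩ := hcut T ε hε
  set φ : ℝ × Heis N → ℝ := fun z => χ z.1 * ψ z with hφdef
  have hφ0 (z) : 0 ≤ φ z := mul_nonneg (hχ0 _) (hψ0 _)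
  have hφψ (z) : φ z ≤ ψ z := mul_le_of_le_one_left (hψ0 _) (hχ1 _)
  have hχ2 : ContDiff ℝ 2 χ := hχ.of_le ENat.LEInfty.out
  have hφ2 : ContDiff ℝ 2 φ := (hχ2.comp contDiff_fst).mul hψ2
  have hφ : IsTestFun N T φ :=
    ⟨hφ2, hψc.mul_left (f := fun z : ℝ × Heis N => χ z.1), hφ0, fun η => by simp [hφdef, hψT]⟩
  have hdt (z) : dirDeriv (1, 0) φ z = deriv χ z.1 * ψ z + χ z.1 * dirDeriv (1, 0) ψ z := by
    rw [← deriv_time_eq (hφ2.differentiable two_ne_zero),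
      ← deriv_time_eq (hψ2.differentiable two_ne_zero)]
    have hψz : DifferentiableAt ℝ (fun s => ψ (s, z.2)) z.1 :=
      DifferentiableAt.comp (g := ψ) z.1 (hψ2.differentiable two_ne_zero (z.1, z.2))
        (by fun_prop : DifferentiableAt ℝ (fun s : ℝ => (s, z.2)) z.1)
    exact ((hχ2.differentiable two_ne_zero z.1).hasDerivAt.mul hψz.hasDerivAt).deriv
  have hL (z) : slicedSubLaplacian φ z = χ z.1 * slicedSubLaplacian ψ z := by
    rw [← subLaplacian_slice hφ2, ← subLaplacian_slice hψ2]
    exact subLaplacian_const_mul (χ z.1) (fun ξ => ψ (z.1, ξ)) z.2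
  have hA : IntegrableOn (fun z => |u z| ^ p * φ z) (Ioo 0 T ×ˢ univ) := by
    refine IntegrableOn.of_forall_sdiff_eq_zero
      (hu.integrableOn_source_mul_test hT hu₀ hf hφ (b := T - ε) (by linarith) (by linarith))
      (measurableSet_Ioo.prod .univ) fun z hz => ?_
    have hz1 : T - ε ≤ z.1 := le_of_not_gt fun h => hz.2 ⟨⟨hz.1.1.1, h⟩, trivial⟩
    simp [hφdef, hχz _ hz1]
  set L : Set (ℝ × Heis N) := Icc (T - 2 * ε) T ×ˢ univ with hLdef
  have hLm : MeasurableSet L := measurableSet_Icc.prod .univ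
  have iψ : Integrable ψ := hψ2.continuous.integrable_of_hasCompactSupport hψc
  have iL : Integrable (L.indicator ψ) := iψ.indicator hLm
  set E := C * (D / ε) ^ (p / (p - 1)) with hEdef
  have hE0 : 0 ≤ E := by positivity
  have hbasic {g : ℝ × Heis N → ℝ} (hg : ∀ᵐ z, ψ z = 0 → g z = 0) :
      ∀ᵐ z, |u z * (χ z.1 * g z)| ≤ 1 / 6 * (|u z| ^ p * φ z) + C * capDensity p ψ g z := by
    filter_upwards [hg] with z hz
    have h := mul_le_mul_of_nonneg_left
      (mul_le_young_capDensity hp (κ := 1 / 6) (by norm_num) (abs_nonneg (u z)) hψ0 hz) (hχ0 z.1)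
    have h2 : χ z.1 * (C * capDensity p ψ g z) ≤ C * capDensity p ψ g z :=
      mul_le_of_le_one_left (mul_nonneg hC0 (capDensity_nonneg hψ0 _ _)) (hχ1 _)
    rw [abs_mul, abs_mul, abs_of_nonneg (hχ0 _)]
    calc |u z| * (χ z.1 * |g z|) = χ z.1 * (|u z| * |g z|) := by ring
      _ ≤ χ z.1 * (1 / 6 * (|u z| ^ p * ψ z)) + χ z.1 * (C * capDensity p ψ g z) := by
        rw [← mul_add]; exact h
      _ ≤ χ z.1 * (1 / 6 * (|u z| ^ p * ψ z)) + C * capDensity p ψ g z := by gcongr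
      _ = _ := by simp only [hφdef]; ring
  have hcutoff (z) : |u z * (deriv χ z.1 * ψ z)|
      ≤ 1 / 6 * (|u z| ^ p * φ z) + E * L.indicator ψ z := by
    have hup : 0 ≤ |u z| ^ p := rpow_nonneg (abs_nonneg _) _
    by_cases hz : z.1 ∈ Icc (T - 2 * ε) T
    · rw [indicator_of_mem (show z ∈ L from ⟨hz, trivial⟩)]
      have hχp : 0 ≤ χ z.1 ^ (1 / p) := rpow_nonneg (hχ0 _) _
      have h := mul_le_weighted_young hp (κ := 1 / 6) (by norm_num)
        (mul_nonneg (abs_nonneg (u z)) hχp) one_pos (div_nonneg hD hε.le)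
      rw [mul_rpow (abs_nonneg _) hχp, ← rpow_mul (hχ0 _), one_div_mul_cancel hp0.ne', rpow_one,
        one_rpow, one_mul, mul_one] at h
      rw [abs_mul, abs_mul, abs_of_nonneg (hψ0 z)]
      calc |u z| * (|deriv χ z.1| * ψ z) ≤ |u z| * (D / ε * χ z.1 ^ (1 / p) * ψ z) := by
            have := hψ0 z
            have := hχd z.1
            gcongr
        _ = |u z| * χ z.1 ^ (1 / p) * (D / ε) * ψ z := by ring
        _ ≤ (1 / 6 * (|u z| ^ p * χ z.1) + C * (D / ε) ^ (p / (p - 1))) * ψ z :=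
            mul_le_mul_of_nonneg_right h (hψ0 z)
        _ = _ := by simp only [hφdef, hEdef]; ring
    · rw [hχs _ hz, zero_mul, mul_zero, abs_zero]
      have h1 := mul_nonneg hE0 (indicator_nonneg (s := L) (fun z _ => hψ0 z) z)
      have h2 := mul_nonneg hup (hφ0 z)
      linarith
  have hb₁ : ∀ᵐ z, |u z * dirDeriv (1, 0) φ z|
      ≤ 1 / 3 * (|u z| ^ p * φ z) + C * k₁ z + E * L.indicator ψ z := by
    filter_upwards [hbasic (ae_dirDeriv_eq_zero volume (hψ2.of_le one_le_two) (1, 0))] with z hz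
    rw [hdt, mul_add]
    refine (abs_add_le _ _).trans ((add_le_add (hcutoff z) hz).trans (le_of_eq ?_))
    ring
  have hb₂ : ∀ᵐ z, |u z * slicedSubLaplacian φ z| ≤ 1 / 6 * (|u z| ^ p * φ z) + C * k₂ z := by
    filter_upwards [hbasic (ae_slicedSubLaplacian_eq_zero hψ2)] with z hz
    rwa [hL]
  have j₁ : IntegrableOn (fun z => 1 / 3 * (|u z| ^ p * φ z) + C * k₁ z) (Ioo 0 T ×ˢ univ) :=
    (hA.const_mul (1 / 3)).add (hK₁.integrableOn.const_mul C)
  have key := hu.integral_source_add_le hu₀0 hφ hA (j₁.add (iL.integrableOn.const_mul E))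
    ((hA.const_mul (1 / 6)).add (hK₂.integrableOn.const_mul C)) hb₁ hb₂
  simp only [Pi.add_apply] at key
  rw [integral_add j₁ (iL.integrableOn.const_mul E),
    integral_add (hA.const_mul (1 / 3)) (hK₁.integrableOn.const_mul C),
    integral_add (hA.const_mul (1 / 6)) (hK₂.integrableOn.const_mul C)] at key
  simp only [integral_const_mul] at key
  have hF := abs_integral_forcing_le hT hfθ hφ0 fun z => (hφψ z).trans (hψθ z)
  have hk₁S := mul_le_mul_of_nonneg_left (setIntegral_le_integral
    (s := Ioo (0 : ℝ) T ×ˢ (univ : Set (Heis N))) hK₁ (.of_forall (capDensity_nonneg hψ0 _))) hC0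
  have hk₂S := mul_le_mul_of_nonneg_left (setIntegral_le_integral
    (s := Ioo (0 : ℝ) T ×ˢ (univ : Set (Heis N))) hK₂ (.of_forall (capDensity_nonneg hψ0 _))) hC0
  have hlayer : E * ∫ z in Ioo 0 T ×ˢ univ, L.indicator ψ z
      ≤ C * (D ^ (p / (p - 1)) * (4 * youngConst p (1 / 4) * ∫ z, k₁ z)) := by
    have h1 : ∫ z in Ioo 0 T ×ˢ univ, L.indicator ψ z ≤ ∫ z in L, ψ z := by
      rw [← integral_indicator hLm]
      exact setIntegral_le_integral iL (.of_forall (indicator_nonneg fun z _ => hψ0 z))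
    refine (mul_le_mul_of_nonneg_left
      (h1.trans (hψ.setIntegral_terminal_layer_le hp hK₁ hε)) hE0).trans (le_of_eq ?_)
    have hεp : 0 < ε ^ (p / (p - 1)) := rpow_pos_of_pos hε _
    rw [hEdef, div_rpow hD hε.le, ← hk₁]
    field_simp
  have hfinal : ∫ z in Ioo 0 (T - 2 * ε) ×ˢ univ, |u z| ^ p * ψ z
      ≤ ∫ z in Ioo 0 T ×ˢ univ, |u z| ^ p * φ z := by
    have hcongr : ∫ z in Ioo 0 (T - 2 * ε) ×ˢ univ, |u z| ^ p * ψ z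
        = ∫ z in Ioo 0 (T - 2 * ε) ×ˢ univ, |u z| ^ p * φ z :=
      setIntegral_congr_fun (measurableSet_Ioo.prod .univ) fun z hz => by
        simp [hφdef, hχo z.1 hz.1.2.le]
    rw [hcongr]
    exact setIntegral_mono_set hA
      (.of_forall fun z => mul_nonneg (rpow_nonneg (abs_nonneg _) _) (hφ0 z))
      (prod_mono (Ioo_subset_Ioo_right (by linarith)) le_rfl).eventuallyLE
  linarith [neg_le_of_abs_le hF]

lemma IsWeakSol.integrableOn_source_mul_of_capacity (hu : IsWeakSol N p T u₀ f u) (hp : 1 < p)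
    (hT : 0 < T) (hu₀ : LocallyIntegrable u₀) (hu₀0 : ∀ η, 0 ≤ u₀ η) (hf : LocallyIntegrable f)
    (hψ : IsTestFun N T ψ) (hK₁ : Integrable (capDensity p ψ (dirDeriv (1, 0) ψ)))
    (hK₂ : Integrable (capDensity p ψ (slicedSubLaplacian ψ))) :
    IntegrableOn (fun z => |u z| ^ p * ψ z) (Ioo 0 T ×ˢ univ) := by
  obtain ⟨M, hM⟩ := hu.exists_bound_source_mul_test hp hT hu₀ hu₀0 hf hψ hK₁ hK₂
  let ε : ℕ → ℝ := fun n => T / (n + 3)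
  have hε (n : ℕ) : 0 < ε n := by positivity
  have hεT (n : ℕ) : 2 * ε n < T := by
    have : (0 : ℝ) ≤ n := n.cast_nonneg
    simp only [ε]
    rw [← mul_div_assoc, div_lt_iff₀ (by positivity)]
    nlinarith
  have hlim : Filter.Tendsto ε Filter.atTop (nhds 0) :=
    tendsto_const_nhds.div_atTop
      (Filter.tendsto_atTop_add_const_right _ _ tendsto_natCast_atTop_atTop)
  have hcov : AECover (volume.restrict (Ioo (0 : ℝ) T ×ˢ (univ : Set (Heis N)))) Filter.atTop
      fun n => Ioo 0 (T - 2 * ε n) ×ˢ univ := by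
    refine ⟨?_, fun n => measurableSet_Ioo.prod .univ⟩
    filter_upwards [ae_restrict_mem (measurableSet_Ioo.prod .univ)] with z hz
    have h0 : (0 : ℝ) < (T - z.1) / 2 := by linarith [hz.1.2]
    filter_upwards [hlim.eventually_lt_const h0] with n hn
    exact ⟨⟨hz.1.1, by linarith⟩, trivial⟩
  have hres (n : ℕ) : (volume.restrict (Ioo (0 : ℝ) T ×ˢ (univ : Set (Heis N)))).restrict
      (Ioo 0 (T - 2 * ε n) ×ˢ univ) = volume.restrict (Ioo 0 (T - 2 * ε n) ×ˢ univ) :=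
    Measure.restrict_restrict_of_subset
      (prod_mono (Ioo_subset_Ioo_right (by linarith [hε n])) le_rfl)
  refine hcov.integrable_of_integral_bounded_of_nonneg_ae M (fun n => ?_)
    (.of_forall fun z => mul_nonneg (rpow_nonneg (abs_nonneg _) _) (hψ.2.2.1 z))
    (.of_forall fun n => ?_)
  · rw [IntegrableOn, hres]
    exact hu.integrableOn_source_mul_test hT hu₀ hf hψ (by linarith [hεT n]) (by linarith [hε n])
  · rw [hres]
    exact hM _ (hε n) (hεT n)

end Integrability

/-- nonlinear capacity estimate: if `u` is a weak solution on `(0,T)` and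
`ψ` is an admissible test function with `K₁, K₂` finite, then
`∫₀^T ∫ f ψ ≤ (1/p')(2/p)^{p'−1}(K₁ + K₂)` where `p' = p/(p−1)`. -/
theorem capacity_estimate {N : ℕ} (hN : 1 ≤ N) (p : ℝ) (hp : 1 < p)
    (T : ℝ) (hT : 0 < T)
    (u₀ : Heis N → ℝ) (hu₀ : LocallyIntegrable u₀ (volume : Measure (Heis N)))
    (hu₀0 : ∀ η, 0 ≤ u₀ η)
    (f : Heis N → ℝ) (hf : LocallyIntegrable f (volume : Measure (Heis N)))
    (u : ℝ × Heis N → ℝ) (hu : IsWeakSol N p T u₀ f u)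
    (ψ : ℝ × Heis N → ℝ) (hψ : IsTestFun N T ψ)
    (hK1 : IntegrableOn
      (fun z : ℝ × Heis N =>
        ψ z ^ (-(1 / (p - 1))) * |deriv (fun s => ψ (s, z.2)) z.1| ^ (p / (p - 1)))
      {z : ℝ × Heis N | 0 < ψ z} volume)
    (hK2 : IntegrableOn
      (fun z : ℝ × Heis N =>
        ψ z ^ (-(1 / (p - 1))) * |subLaplacian (fun ξ => ψ (z.1, ξ)) z.2| ^ (p / (p - 1)))
      {z : ℝ × Heis N | 0 < ψ z} volume) :
    (∫ t in Ioo (0 : ℝ) T, ∫ η, f η * ψ (t, η))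
      ≤ (1 / (p / (p - 1))) * (2 / p) ^ (p / (p - 1) - 1) *
        ((∫ z in {z : ℝ × Heis N | 0 < ψ z},
            ψ z ^ (-(1 / (p - 1))) * |deriv (fun s => ψ (s, z.2)) z.1| ^ (p / (p - 1)))
          + ∫ z in {z : ℝ × Heis N | 0 < ψ z},
              ψ z ^ (-(1 / (p - 1)))
                * |subLaplacian (fun ξ => ψ (z.1, ξ)) z.2| ^ (p / (p - 1))) := by
  have hp1 : 0 < p - 1 := by linarith
  obtain ⟨hψ2, -, hψ0, -⟩ := id hψ
  have hpos : MeasurableSet {z | 0 < ψ z} :=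
    (isOpen_lt continuous_const hψ2.continuous).measurableSet
  have ht (z : ℝ × Heis N) : deriv (fun s => ψ (s, z.2)) z.1 = dirDeriv (1, 0) ψ z :=
    deriv_time_eq (hψ2.differentiable two_ne_zero) z
  simp only [ht, subLaplacian_slice hψ2] at hK1 hK2 ⊢
  rw [← integral_indicator hpos, ← integral_indicator hpos]
  replace hK1 : Integrable (capDensity p ψ (dirDeriv (1, 0) ψ)) :=
    (integrable_indicator_iff hpos).mpr hK1
  replace hK2 : Integrable (capDensity p ψ (slicedSubLaplacian ψ)) :=
    (integrable_indicator_iff hpos).mpr hK2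
  have hA := hu.integrableOn_source_mul_of_capacity hp hT hu₀ hu₀0 hf hψ hK1 hK2
  have hconst : 1 / (p / (p - 1)) * (2 / p) ^ (p / (p - 1) - 1) = youngConst p (1 / 2) := by
    rw [youngConst]
    congr 2
    field_simp
  have hC0 : 0 ≤ youngConst p (1 / 2) := youngConst_nonneg hp (by norm_num)
  have hb {g : ℝ × Heis N → ℝ} (hg : ∀ᵐ z, ψ z = 0 → g z = 0) : ∀ᵐ z, |u z * g z|
      ≤ 1 / 2 * (|u z| ^ p * ψ z) + youngConst p (1 / 2) * capDensity p ψ g z := by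
    filter_upwards [hg] with z hz
    rw [abs_mul]
    exact mul_le_young_capDensity hp (by norm_num) (abs_nonneg _) hψ0 hz
  have key := hu.integral_source_add_le hu₀0 hψ hA
    ((hA.const_mul (1 / 2)).add (hK1.integrableOn.const_mul (youngConst p (1 / 2))))
    ((hA.const_mul (1 / 2)).add (hK2.integrableOn.const_mul (youngConst p (1 / 2))))
    (hb (ae_dirDeriv_eq_zero volume (hψ2.of_le one_le_two) (1, 0)))
    (hb (ae_slicedSubLaplacian_eq_zero hψ2))
  simp only [Pi.add_apply] at key
  rw [integral_add (hA.const_mul (1 / 2)) (hK1.integrableOn.const_mul _),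
    integral_add (hA.const_mul (1 / 2)) (hK2.integrableOn.const_mul _)] at key
  simp only [integral_const_mul] at key
  have h1 := mul_le_mul_of_nonneg_left (setIntegral_le_integral
    (s := Ioo (0 : ℝ) T ×ˢ (univ : Set (Heis N))) hK1 (.of_forall (capDensity_nonneg hψ0 _))) hC0
  have h2 := mul_le_mul_of_nonneg_left (setIntegral_le_integral
    (s := Ioo (0 : ℝ) T ×ˢ (univ : Set (Heis N))) hK2 (.of_forall (capDensity_nonneg hψ0 _))) hC0
  rw [hconst, mul_add]
  change _ ≤ youngConst p (1 / 2) * (∫ z, capDensity p ψ (dirDeriv (1, 0) ψ) z)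
    + youngConst p (1 / 2) * ∫ z, capDensity p ψ (slicedSubLaplacian ψ) z
  linarith
end
end

section
/- Let N ≥ 1, Q = 2N + 2 and 1 < p < Q/(Q−2). Let u₀ ∈ L¹_loc(ℝ^{2N+1}) be nonnegative, f ∈ L¹(ℝ^{2N+1}), and let u be a global weak solution of u_t − Δ_ℍ u = |u|^p + f with datum u₀ (i.e., a weak solution on (0, T) for every T > 0). Let Φ ∈ C²([0, ∞)) satisfy 0 ≤ Φ ≤ 1, Φ ≡ 1 on [0, 1], Φ ≡ 0 on [2, ∞). Then there exists a constant C > 0 such that for all sufficiently large T, ∫_{ℝ^{2N+1}} f(η) Φ(|η|_ℍ⁴ / T²) dη ≤ C T^{λ}, where λ = Q/2 − p/(p−1) < 0. -/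
open MeasureTheory Real Set

noncomputable section

lemma hasDerivAt_max_zero_pow (n : ℕ) (x : ℝ) :
    HasDerivAt (fun x : ℝ => max 0 x ^ (n + 2)) ((n + 2) * max 0 x ^ (n + 1)) x := by
  rcases lt_trichotomy x 0 with hx | rfl | hx
  · have h : (fun x : ℝ => max 0 x ^ (n + 2)) =ᶠ[nhds x] fun _ => 0 := by
      filter_upwards [Iio_mem_nhds hx] with y hy
      simp [max_eq_left (le_of_lt (mem_Iio.1 hy))]
    rw [max_eq_left hx.le]
    simpa using (hasDerivAt_const x (0 : ℝ)).congr_of_eventuallyEq h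
  · have h1 : HasDerivWithinAt (fun x : ℝ => max 0 x ^ (n + 2)) 0 (Iic 0) 0 :=
      (hasDerivWithinAt_const (0 : ℝ) (Iic 0) (0 : ℝ)).congr
        (fun y hy => by simp [max_eq_left (mem_Iic.1 hy)]) (by simp)
    have h2 : HasDerivWithinAt (fun x : ℝ => max 0 x ^ (n + 2)) 0 (Ici 0) 0 := by
      have := (hasDerivAt_pow (n + 2) (0 : ℝ)).hasDerivWithinAt (s := Ici 0)
      simp only [Nat.add_one_sub_one, ne_eq, Nat.succ_ne_zero, not_false_eq_true, zero_pow,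
        mul_zero] at this
      exact (by simpa using this : HasDerivWithinAt (fun x : ℝ => x ^ (n + 2)) 0 (Ici 0) 0).congr
        (fun y hy => by simp [max_eq_right (mem_Ici.1 hy)]) (by simp)
    have h3 := h1.union h2
    rw [Iic_union_Ici, hasDerivWithinAt_univ] at h3
    simpa using h3
  · have h : (fun x : ℝ => max 0 x ^ (n + 2)) =ᶠ[nhds x] fun x => x ^ (n + 2) := by
      filter_upwards [Ioi_mem_nhds hx] with y hy
      simp [max_eq_right (le_of_lt (mem_Ioi.1 hy))]
    rw [max_eq_right hx.le]
    simpa using (hasDerivAt_pow (n + 2) x).congr_of_eventuallyEq h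

/-- The `C²` cut-off `s ↦ (1 - s)₊ ^ (n + 3)`. -/
def polyCut (n : ℕ) (s : ℝ) : ℝ := max 0 (1 - s) ^ (n + 3)

lemma hasDerivAt_polyCut (n : ℕ) (s : ℝ) :
    HasDerivAt (polyCut n) (-((n + 3) * max 0 (1 - s) ^ (n + 2))) s := by
  have h := (hasDerivAt_max_zero_pow (n + 1) (1 - s)).comp s ((hasDerivAt_id s).const_sub 1)
  refine HasDerivAt.congr_deriv h ?_
  push_cast
  ring

lemma deriv_polyCut (n : ℕ) :
    deriv (polyCut n) = fun s => -(((n : ℝ) + 3) * max 0 (1 - s) ^ (n + 2)) :=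
  funext fun s => (hasDerivAt_polyCut n s).deriv

lemma hasDerivAt_deriv_polyCut (n : ℕ) (s : ℝ) :
    HasDerivAt (deriv (polyCut n)) ((n + 3) * (n + 2) * max 0 (1 - s) ^ (n + 1)) s := by
  rw [deriv_polyCut]
  have h := (((hasDerivAt_max_zero_pow n (1 - s)).comp s
    ((hasDerivAt_id s).const_sub 1)).const_mul ((n : ℝ) + 3)).neg
  refine HasDerivAt.congr_deriv h ?_
  ring

lemma deriv_deriv_polyCut (n : ℕ) :
    deriv (deriv (polyCut n)) = fun s => ((n : ℝ) + 3) * (n + 2) * max 0 (1 - s) ^ (n + 1) :=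
  funext fun s => (hasDerivAt_deriv_polyCut n s).deriv

lemma contDiff_two_of_deriv {g : ℝ → ℝ} (h0 : Differentiable ℝ g)
    (h1 : Differentiable ℝ (deriv g)) (h2 : Continuous (deriv (deriv g))) : ContDiff ℝ 2 g := by
  have e : (2 : WithTop ℕ∞) = 1 + 1 := by norm_num
  rw [e, contDiff_succ_iff_deriv]
  exact ⟨h0, by simp, contDiff_one_iff_deriv.2 ⟨h1, h2⟩⟩

lemma contDiff_polyCut (n : ℕ) : ContDiff ℝ 2 (polyCut n) :=
  contDiff_two_of_deriv (fun s => (hasDerivAt_polyCut n s).differentiableAt)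
    (fun s => (hasDerivAt_deriv_polyCut n s).differentiableAt)
    (by rw [deriv_deriv_polyCut]; fun_prop)

lemma polyCut_nonneg (n : ℕ) (s : ℝ) : 0 ≤ polyCut n s := by unfold polyCut; positivity

lemma polyCut_eq_zero (n : ℕ) {s : ℝ} (hs : 1 ≤ s) : polyCut n s = 0 := by
  simp [polyCut, max_eq_left (sub_nonpos.2 hs)]

lemma polyCut_le_one (n : ℕ) {s : ℝ} (hs : 0 ≤ s) : polyCut n s ≤ 1 :=
  pow_le_one₀ (le_max_left _ _) (max_le zero_le_one (by linarith))

/-- For an exponent `n + 3` large in terms of `p`, the derivatives of `polyCut n` of order at most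
two are controlled by its power `1 / p`. -/
lemma max_pow_le_polyCut_rpow {p : ℝ} (hp : 1 < p) {n k : ℕ} (hn : 2 * p ≤ (n + 3) * (p - 1))
    (hk : n + 1 ≤ k) {s : ℝ} (hs : 0 ≤ s) :
    max 0 (1 - s) ^ k ≤ polyCut n s ^ (1 / p) := by
  have hm0 : 0 ≤ max 0 (1 - s) := le_max_left _ _
  have hm1 : max 0 (1 - s) ≤ 1 := max_le zero_le_one (by linarith)
  unfold polyCut
  rw [← Real.rpow_natCast, ← Real.rpow_natCast, ← Real.rpow_mul hm0]
  apply Real.rpow_le_rpow_of_exponent_ge_of_imp hm0 hm1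
  · rw [mul_one_div, div_le_iff₀ (by linarith)]
    have : (n : ℝ) + 1 ≤ k := by exact_mod_cast hk
    push_cast
    nlinarith
  · intro _ h
    have : k ≠ 0 := by omega
    exact absurd h (by exact_mod_cast this)

/-- A `C²` cut-off in time, supported in `[1/4, 3/4]`. -/
def timeCut (n : ℕ) (t : ℝ) : ℝ := polyCut n ((4 * t - 2) ^ 2)

lemma hasDerivAt_timeCut (n : ℕ) (t : ℝ) :
    HasDerivAt (timeCut n)
      (-((n + 3) * max 0 (1 - (4 * t - 2) ^ 2) ^ (n + 2)) * (8 * (4 * t - 2))) t := by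
  have h : HasDerivAt (fun t : ℝ => (4 * t - 2) ^ 2) (8 * (4 * t - 2)) t := by
    have := (((hasDerivAt_id t).const_mul 4).sub_const 2).pow 2
    refine HasDerivAt.congr_deriv this ?_
    simp only [id]
    ring
  exact (hasDerivAt_polyCut n _).comp t h

lemma contDiff_timeCut (n : ℕ) : ContDiff ℝ 2 (timeCut n) :=
  (contDiff_polyCut n).comp (by fun_prop)

lemma timeCut_nonneg (n : ℕ) (t : ℝ) : 0 ≤ timeCut n t := polyCut_nonneg _ _

lemma timeCut_le_one (n : ℕ) (t : ℝ) : timeCut n t ≤ 1 := polyCut_le_one _ (sq_nonneg _)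

lemma one_le_sq_of_notMem {t : ℝ} (ht : t ∉ Icc (1 / 4 : ℝ) (3 / 4)) : 1 ≤ (4 * t - 2) ^ 2 := by
  by_contra! h
  have := abs_lt_of_sq_lt_sq (by linarith : (4 * t - 2) ^ 2 < 1 ^ 2) zero_le_one
  rw [abs_lt] at this
  exact ht ⟨by linarith, by linarith⟩

lemma timeCut_eq_zero (n : ℕ) {t : ℝ} (ht : t ∉ Icc (1 / 4 : ℝ) (3 / 4)) : timeCut n t = 0 :=
  polyCut_eq_zero n (one_le_sq_of_notMem ht)

lemma deriv_timeCut_eq_zero (n : ℕ) {t : ℝ} (ht : t ∉ Icc (1 / 4 : ℝ) (3 / 4)) :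
    deriv (timeCut n) t = 0 := by
  rw [(hasDerivAt_timeCut n t).deriv, max_eq_left (by linarith [one_le_sq_of_notMem ht])]
  simp

lemma abs_deriv_timeCut_le {p : ℝ} (hp : 1 < p) {n : ℕ} (hn : 2 * p ≤ (n + 3) * (p - 1)) (t : ℝ) :
    |deriv (timeCut n) t| ≤ 8 * (n + 3) * timeCut n t ^ (1 / p) := by
  by_cases ht : t ∈ Icc (1 / 4 : ℝ) (3 / 4)
  · rw [(hasDerivAt_timeCut n t).deriv]
    have h1 : |4 * t - 2| ≤ 1 := abs_le.2 ⟨by linarith [ht.1], by linarith [ht.2]⟩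
    have h2 := max_pow_le_polyCut_rpow hp hn (k := n + 2) (by omega) (sq_nonneg (4 * t - 2))
    have h3 : 0 ≤ max 0 (1 - (4 * t - 2) ^ 2) ^ (n + 2) := by positivity
    rw [abs_mul, abs_neg, abs_mul, abs_mul, abs_of_nonneg h3, abs_of_pos (by norm_num : (0:ℝ) < 8),
      abs_of_pos (by positivity : (0 : ℝ) < n + 3)]
    have h4 := Real.rpow_nonneg (polyCut_nonneg n ((4 * t - 2) ^ 2)) (1 / p)
    calc (n + 3) * max 0 (1 - (4 * t - 2) ^ 2) ^ (n + 2) * (8 * |4 * t - 2|)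
        ≤ (n + 3) * polyCut n ((4 * t - 2) ^ 2) ^ (1 / p) * (8 * 1) := by gcongr
      _ = _ := by rw [timeCut]; ring
  · rw [deriv_timeCut_eq_zero n ht, abs_zero]
    have := timeCut_nonneg n t
    positivity

lemma hasCompactSupport_timeCut (n : ℕ) : HasCompactSupport (timeCut n) :=
  HasCompactSupport.intro isCompact_Icc fun _ ht => timeCut_eq_zero n ht

lemma integral_timeCut_pos (n : ℕ) : 0 < ∫ t, timeCut n t := by
  refine (contDiff_timeCut n).continuous.integral_pos_of_hasCompactSupport_nonneg_nonzero
    (hasCompactSupport_timeCut n) (fun t => timeCut_nonneg n t) (x := 1 / 2) ?_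
  norm_num [timeCut, polyCut]

/-- `|z|² = |x|² + |y|²` for `η = (x, y, τ)`. -/
def heisHorizSq {N : ℕ} (η : Heis N) : ℝ := (∑ i : Fin N, (η.1 i) ^ 2) + ∑ i : Fin N, (η.2.1 i) ^ 2

lemma heisNorm4_eq {N : ℕ} (η : Heis N) : heisNorm4 η = heisHorizSq η ^ 2 + η.2.2 ^ 2 := rfl

lemma heisHorizSq_nonneg {N : ℕ} (η : Heis N) : 0 ≤ heisHorizSq η := by
  unfold heisHorizSq; positivity

lemma heisNorm4_nonneg {N : ℕ} (η : Heis N) : 0 ≤ heisNorm4 η := by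
  rw [heisNorm4_eq]; positivity

lemma contDiff_heisHorizSq {N : ℕ} : ContDiff ℝ 2 (heisHorizSq : Heis N → ℝ) := by
  unfold heisHorizSq; fun_prop

lemma contDiff_heisNorm4 {N : ℕ} : ContDiff ℝ 2 (heisNorm4 : Heis N → ℝ) := by
  unfold heisNorm4; fun_prop

lemma hasDerivAt_sum_sq_update {N : ℕ} (i : Fin N) (x : Fin N → ℝ) :
    HasDerivAt (fun s => ∑ j, (Function.update x i s j) ^ 2) (2 * x i) (x i) := by
  have h : ∀ j ∈ Finset.univ, HasDerivAt (fun s => (Function.update x i s j) ^ 2)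
      (if j = i then 2 * x i else 0) (x i) := by
    intro j _
    by_cases hj : j = i
    · subst hj
      simpa using hasDerivAt_pow 2 (x j)
    · simpa [hj] using hasDerivAt_const (x i) (x j ^ 2)
  simpa using HasDerivAt.fun_sum h

lemma hasDerivAt_heisHorizSq_x {N : ℕ} (i : Fin N) (η : Heis N) :
    HasDerivAt (fun s => heisHorizSq ((Function.update η.1 i s, η.2.1, η.2.2) : Heis N))
      (2 * η.1 i) (η.1 i) :=
  (hasDerivAt_sum_sq_update i η.1).add_const (∑ j, η.2.1 j ^ 2)

lemma hasDerivAt_heisHorizSq_y {N : ℕ} (i : Fin N) (η : Heis N) :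
    HasDerivAt (fun s => heisHorizSq ((η.1, Function.update η.2.1 i s, η.2.2) : Heis N))
      (2 * η.2.1 i) (η.2.1 i) :=
  (hasDerivAt_sum_sq_update i η.2.1).const_add (∑ j, η.1 j ^ 2)

lemma hasDerivAt_heisNorm4_x {N : ℕ} (i : Fin N) (η : Heis N) :
    HasDerivAt (fun s => heisNorm4 ((Function.update η.1 i s, η.2.1, η.2.2) : Heis N))
      (4 * heisHorizSq η * η.1 i) (η.1 i) := by
  have h := ((hasDerivAt_heisHorizSq_x i η).pow 2).add_const (η.2.2 ^ 2)
  refine HasDerivAt.congr_deriv h ?_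
  simp
  ring

lemma hasDerivAt_heisNorm4_y {N : ℕ} (i : Fin N) (η : Heis N) :
    HasDerivAt (fun s => heisNorm4 ((η.1, Function.update η.2.1 i s, η.2.2) : Heis N))
      (4 * heisHorizSq η * η.2.1 i) (η.2.1 i) := by
  have h := ((hasDerivAt_heisHorizSq_y i η).pow 2).add_const (η.2.2 ^ 2)
  refine HasDerivAt.congr_deriv h ?_
  simp
  ring

lemma hasDerivAt_heisNorm4_t {N : ℕ} (η : Heis N) :
    HasDerivAt (fun s => heisNorm4 ((η.1, η.2.1, s) : Heis N)) (2 * η.2.2) η.2.2 := by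
  have h := (hasDerivAt_pow 2 η.2.2).const_add (heisHorizSq η ^ 2)
  refine HasDerivAt.congr_deriv h ?_
  simp

/-- The sub-Laplacian of a function of the homogeneous norm. -/
lemma subLaplacian_radial {N : ℕ} {g g1 g2 : ℝ → ℝ} (h1 : ∀ s, HasDerivAt g (g1 s) s)
    (h2 : ∀ s, HasDerivAt g1 (g2 s) s) (η : Heis N) :
    subLaplacian (fun ξ : Heis N => g (heisNorm4 ξ)) η =
      16 * heisHorizSq η * heisNorm4 η * g2 (heisNorm4 η)
        + (8 * N + 16) * heisHorizSq η * g1 (heisNorm4 η) := by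
  have ex : ∀ i (ξ : Heis N), ((Function.update ξ.1 i (ξ.1 i), ξ.2.1, ξ.2.2) : Heis N) = ξ := by
    intro i ξ; simp
  have ey : ∀ i (ξ : Heis N), ((ξ.1, Function.update ξ.2.1 i (ξ.2.1 i), ξ.2.2) : Heis N) = ξ := by
    intro i ξ; simp
  have gx : ∀ {g g1 : ℝ → ℝ}, (∀ s, HasDerivAt g (g1 s) s) → ∀ i (ξ : Heis N), HasDerivAt
      (fun s => g (heisNorm4 ((Function.update ξ.1 i s, ξ.2.1, ξ.2.2) : Heis N)))
      (g1 (heisNorm4 ξ) * (4 * heisHorizSq ξ * ξ.1 i)) (ξ.1 i) := by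
    intro g g1 h i ξ
    have := (h (heisNorm4 ((Function.update ξ.1 i (ξ.1 i), ξ.2.1, ξ.2.2) : Heis N))).comp (ξ.1 i)
      (hasDerivAt_heisNorm4_x i ξ)
    rwa [ex] at this
  have gy : ∀ {g g1 : ℝ → ℝ}, (∀ s, HasDerivAt g (g1 s) s) → ∀ i (ξ : Heis N), HasDerivAt
      (fun s => g (heisNorm4 ((ξ.1, Function.update ξ.2.1 i s, ξ.2.2) : Heis N)))
      (g1 (heisNorm4 ξ) * (4 * heisHorizSq ξ * ξ.2.1 i)) (ξ.2.1 i) := by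
    intro g g1 h i ξ
    have := (h (heisNorm4 ((ξ.1, Function.update ξ.2.1 i (ξ.2.1 i), ξ.2.2) : Heis N))).comp
      (ξ.2.1 i) (hasDerivAt_heisNorm4_y i ξ)
    rwa [ey] at this
  have gt : ∀ {g g1 : ℝ → ℝ}, (∀ s, HasDerivAt g (g1 s) s) → ∀ (ξ : Heis N), HasDerivAt
      (fun s => g (heisNorm4 ((ξ.1, ξ.2.1, s) : Heis N)))
      (g1 (heisNorm4 ξ) * (2 * ξ.2.2)) ξ.2.2 :=
    fun h ξ => (h (heisNorm4 ξ)).comp ξ.2.2 (hasDerivAt_heisNorm4_t ξ)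
  have px : ∀ i, pdx i (fun ξ : Heis N => g (heisNorm4 ξ)) =
      fun ξ => g1 (heisNorm4 ξ) * (4 * heisHorizSq ξ * ξ.1 i) :=
    fun i => funext fun ξ => (gx h1 i ξ).deriv
  have py : ∀ i, pdy i (fun ξ : Heis N => g (heisNorm4 ξ)) =
      fun ξ => g1 (heisNorm4 ξ) * (4 * heisHorizSq ξ * ξ.2.1 i) :=
    fun i => funext fun ξ => (gy h1 i ξ).deriv
  have pt : pdt (fun ξ : Heis N => g (heisNorm4 ξ)) =
      fun ξ => g1 (heisNorm4 ξ) * (2 * ξ.2.2) :=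
    funext fun ξ => (gt h1 ξ).deriv
  have pxx : ∀ i, pdx i (fun ξ : Heis N => g1 (heisNorm4 ξ) * (4 * heisHorizSq ξ * ξ.1 i)) η =
      g2 (heisNorm4 η) * (4 * heisHorizSq η * η.1 i) * (4 * heisHorizSq η * η.1 i)
        + g1 (heisNorm4 η) * (4 * (2 * η.1 i) * η.1 i + 4 * heisHorizSq η) := by
    intro i
    have := ((gx h2 i η).mul (((hasDerivAt_heisHorizSq_x i η).const_mul 4).mul
      (hasDerivAt_id (η.1 i)))).deriv
    simp only [Pi.mul_def, ex, id, mul_one] at this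
    simpa [pdx] using this
  have pyy : ∀ i, pdy i (fun ξ : Heis N => g1 (heisNorm4 ξ) * (4 * heisHorizSq ξ * ξ.2.1 i)) η =
      g2 (heisNorm4 η) * (4 * heisHorizSq η * η.2.1 i) * (4 * heisHorizSq η * η.2.1 i)
        + g1 (heisNorm4 η) * (4 * (2 * η.2.1 i) * η.2.1 i + 4 * heisHorizSq η) := by
    intro i
    have := ((gy h2 i η).mul (((hasDerivAt_heisHorizSq_y i η).const_mul 4).mul
      (hasDerivAt_id (η.2.1 i)))).deriv
    simp only [Pi.mul_def, ey, id, mul_one] at this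
    simpa [pdy] using this
  have pxt : ∀ i, pdx i (fun ξ : Heis N => g1 (heisNorm4 ξ) * (2 * ξ.2.2)) η =
      g2 (heisNorm4 η) * (4 * heisHorizSq η * η.1 i) * (2 * η.2.2) :=
    fun i => ((gx h2 i η).mul_const (2 * η.2.2)).deriv
  have pyt : ∀ i, pdy i (fun ξ : Heis N => g1 (heisNorm4 ξ) * (2 * ξ.2.2)) η =
      g2 (heisNorm4 η) * (4 * heisHorizSq η * η.2.1 i) * (2 * η.2.2) :=
    fun i => ((gy h2 i η).mul_const (2 * η.2.2)).deriv
  have ptt : pdt (fun ξ : Heis N => g1 (heisNorm4 ξ) * (2 * ξ.2.2)) η =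
      g2 (heisNorm4 η) * (2 * η.2.2) * (2 * η.2.2) + g1 (heisNorm4 η) * 2 := by
    have := ((gt h2 η).mul ((hasDerivAt_id η.2.2).const_mul 2)).deriv
    simpa [pdt, Pi.mul_def] using this
  simp only [subLaplacian, px, py, pt, pxx, pyy, pxt, pyt, ptt]
  set r := heisHorizSq η with hr
  set ρ := heisNorm4 η with hρ
  have hρ' : ρ = r ^ 2 + η.2.2 ^ 2 := rfl
  have hsum : ∀ i : Fin N,
      g2 ρ * (4 * r * η.1 i) * (4 * r * η.1 i) + g1 ρ * (4 * (2 * η.1 i) * η.1 i + 4 * r)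
        + (g2 ρ * (4 * r * η.2.1 i) * (4 * r * η.2.1 i)
          + g1 ρ * (4 * (2 * η.2.1 i) * η.2.1 i + 4 * r))
        + 4 * η.2.1 i * (g2 ρ * (4 * r * η.1 i) * (2 * η.2.2))
        - 4 * η.1 i * (g2 ρ * (4 * r * η.2.1 i) * (2 * η.2.2))
        + 4 * (η.1 i ^ 2 + η.2.1 i ^ 2) * (g2 ρ * (2 * η.2.2) * (2 * η.2.2) + g1 ρ * 2)
      = (16 * ρ * g2 ρ + 16 * g1 ρ) * (η.1 i ^ 2 + η.2.1 i ^ 2) + 8 * r * g1 ρ := by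
    intro i; rw [hρ']; ring
  rw [Finset.sum_congr rfl fun i _ => hsum i, Finset.sum_add_distrib, ← Finset.mul_sum,
    Finset.sum_add_distrib]
  change (16 * ρ * g2 ρ + 16 * g1 ρ) * r + _ = _
  simp only [Finset.sum_const, Finset.card_univ, Fintype.card_fin, nsmul_eq_mul]
  ring

/-- The box `|x_i|, |y_i| ≤ b`, `|τ| ≤ b²`, containing the homogeneous ball of radius `b`. -/
def heisBox (N : ℕ) (b : ℝ) : Set (Heis N) :=
  (univ.pi fun _ => Icc (-b) b) ×ˢ (univ.pi fun _ => Icc (-b) b) ×ˢ Icc (-b ^ 2) (b ^ 2)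

lemma isCompact_heisBox (N : ℕ) (b : ℝ) : IsCompact (heisBox N b) :=
  (isCompact_univ_pi fun _ => isCompact_Icc).prod
    ((isCompact_univ_pi fun _ => isCompact_Icc).prod isCompact_Icc)

lemma volume_real_heisBox (N : ℕ) {b : ℝ} (hb : 0 ≤ b) :
    (volume : Measure (Heis N)).real (heisBox N b) = 2 ^ (2 * N + 1) * (b ^ 2) ^ (N + 1) := by
  have h : ∀ c : ℝ, 0 ≤ c → volume.real (univ.pi fun _ : Fin N => Icc (-c) c) = (2 * c) ^ N := by
    intro c hc
    rw [Measure.real, volume_pi_pi]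
    simp [two_mul, hc]
  have hp : ∀ {α β : Type} [MeasureSpace α] [MeasureSpace β] [SigmaFinite (volume : Measure β)]
      (s : Set α) (t : Set β), (volume : Measure (α × β)).real (s ×ˢ t)
        = (volume : Measure α).real s * (volume : Measure β).real t :=
    fun s t => measureReal_prod_prod s t
  rw [heisBox, hp, hp, h b hb, Real.volume_real_Icc_of_le (by nlinarith [sq_nonneg b])]
  ring

lemma heisHorizSq_le {N : ℕ} {η : Heis N} {b : ℝ} (h : heisNorm4 η ≤ (b ^ 2) ^ 2) :
    heisHorizSq η ≤ b ^ 2 := by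
  rw [heisNorm4_eq] at h
  exact abs_le_of_sq_le_sq' (by nlinarith [sq_nonneg η.2.2]) (sq_nonneg b) |>.2

lemma mem_heisBox {N : ℕ} {η : Heis N} {b : ℝ} (hb : 0 ≤ b) (h : heisNorm4 η ≤ (b ^ 2) ^ 2) :
    η ∈ heisBox N b := by
  have hr := heisHorizSq_le h
  have hx : ∀ i, η.1 i ^ 2 ≤ b ^ 2 := fun i => by
    have h1 := Finset.single_le_sum (f := fun i => η.1 i ^ 2) (fun j _ => sq_nonneg _)
      (Finset.mem_univ i)
    have h2 : 0 ≤ ∑ i, η.2.1 i ^ 2 := by positivity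
    simp only [heisHorizSq] at hr h1
    linarith
  have hy : ∀ i, η.2.1 i ^ 2 ≤ b ^ 2 := fun i => by
    have h1 := Finset.single_le_sum (f := fun i => η.2.1 i ^ 2) (fun j _ => sq_nonneg _)
      (Finset.mem_univ i)
    have h2 : 0 ≤ ∑ i, η.1 i ^ 2 := by positivity
    simp only [heisHorizSq] at hr h1
    linarith
  have ht : η.2.2 ^ 2 ≤ (b ^ 2) ^ 2 := by
    rw [heisNorm4_eq] at h
    nlinarith [sq_nonneg (heisHorizSq η)]
  exact ⟨fun i _ => abs_le_of_sq_le_sq' (hx i) hb, fun i _ => abs_le_of_sq_le_sq' (hy i) hb,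
    abs_le_of_sq_le_sq' ht (sq_nonneg b)⟩

lemma integrable_mul_of_locallyIntegrableOn {N : ℕ} {T b : ℝ} (hT : 0 < T) {v G : ℝ × Heis N → ℝ}
    (hv : LocallyIntegrableOn v (Ioo (0 : ℝ) T ×ˢ (univ : Set (Heis N))) volume)
    (hG : Continuous G) (hG0 : ∀ z, z ∉ Icc (T / 4) (3 * T / 4) ×ˢ heisBox N b → G z = 0) :
    Integrable (fun z => v z * G z) := by
  have hK : IsCompact (Icc (T / 4) (3 * T / 4) ×ˢ heisBox N b) :=
    isCompact_Icc.prod (isCompact_heisBox N b)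
  have hsub : Icc (T / 4) (3 * T / 4) ×ˢ heisBox N b ⊆ Ioo (0 : ℝ) T ×ˢ (univ : Set (Heis N)) :=
    prod_mono (fun t ht => ⟨by linarith [ht.1], by linarith [ht.2]⟩) (subset_univ _)
  refine (integrableOn_iff_integrable_of_support_subset ?_).1
    ((hv.integrableOn_compact_subset hsub hK).mul_continuousOn hG.continuousOn hK)
  intro z hz
  by_contra h
  exact hz (by simp [hG0 z h])

lemma setIntegral_integral_eq {N : ℕ} {T : ℝ} {F : ℝ × Heis N → ℝ} (hF : Integrable F)
    (h0 : ∀ t ∉ Ioo (0 : ℝ) T, ∀ η, F (t, η) = 0) :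
    ∫ t in Ioo (0 : ℝ) T, ∫ η, F (t, η) = ∫ z, F z := by
  rw [setIntegral_eq_integral_of_forall_compl_eq_zero fun t ht => by simp [h0 t ht]]
  exact (integral_prod F hF).symm

lemma div_notMem_Icc {T t : ℝ} (hT : 0 < T) (ht : t ∉ Icc (T / 4) (3 * T / 4)) :
    t / T ∉ Icc (1 / 4 : ℝ) (3 / 4) := by
  contrapose! ht
  have h1 := ht.1
  have h2 := ht.2
  rw [le_div_iff₀ hT] at h1
  rw [div_le_iff₀ hT] at h2
  exact ⟨by linarith, by linarith⟩

lemma integral_timeCut_div (n : ℕ) {T : ℝ} (hT : 0 < T) :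
    ∫ t in Ioo (0 : ℝ) T, timeCut n (t / T) = T * ∫ t, timeCut n t := by
  rw [setIntegral_eq_integral_of_forall_compl_eq_zero, Measure.integral_comp_div, abs_of_pos hT,
    smul_eq_mul]
  intro t ht
  exact timeCut_eq_zero n (div_notMem_Icc hT fun h =>
    ht ⟨by linarith [h.1], by linarith [h.2]⟩)

/-- The operator `∂_t + Δ_ℍ` applied to `timeCut n (t / T) * g (|η|_ℍ⁴)`. -/
def heatTest {N : ℕ} (n : ℕ) (T : ℝ) (g : ℝ → ℝ) (z : ℝ × Heis N) : ℝ :=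
  deriv (timeCut n) (z.1 / T) / T * g (heisNorm4 z.2)
    + timeCut n (z.1 / T) * subLaplacian (fun ξ : Heis N => g (heisNorm4 ξ)) z.2

lemma hasDerivAt_of_contDiff_two {g : ℝ → ℝ} (hg : ContDiff ℝ 2 g) :
    (∀ s, HasDerivAt g (deriv g s) s) ∧ (∀ s, HasDerivAt (deriv g) (deriv (deriv g) s) s) ∧
      Continuous (deriv (deriv g)) := by
  have e : (2 : WithTop ℕ∞) = 1 + 1 := by norm_num
  rw [e, contDiff_succ_iff_deriv, contDiff_one_iff_deriv] at hg
  exact ⟨fun s => (hg.1 s).hasDerivAt, fun s => (hg.2.2.1 s).hasDerivAt, hg.2.2.2⟩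

lemma continuous_subLaplacian_radial {N : ℕ} {g : ℝ → ℝ} (hg : ContDiff ℝ 2 g) :
    Continuous fun η : Heis N => subLaplacian (fun ξ : Heis N => g (heisNorm4 ξ)) η := by
  obtain ⟨h1, h2, h3⟩ := hasDerivAt_of_contDiff_two hg
  have c1 : Continuous (deriv g) := continuous_iff_continuousAt.2 fun s => (h2 s).continuousAt
  have cr : Continuous (heisHorizSq : Heis N → ℝ) := contDiff_heisHorizSq.continuous
  have cn : Continuous (heisNorm4 : Heis N → ℝ) := contDiff_heisNorm4.continuous
  simp only [subLaplacian_radial h1 h2]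
  fun_prop

lemma subLaplacian_radial_eq_zero {N : ℕ} {g : ℝ → ℝ} (hg : ContDiff ℝ 2 g) {B : ℝ}
    (hgB : ∀ s, B ≤ s → g s = 0) {η : Heis N} (hη : B < heisNorm4 η) :
    subLaplacian (fun ξ : Heis N => g (heisNorm4 ξ)) η = 0 := by
  obtain ⟨h1, h2, -⟩ := hasDerivAt_of_contDiff_two hg
  have e0 : g =ᶠ[nhds (heisNorm4 η)] fun _ => 0 := by
    filter_upwards [Ioi_mem_nhds hη] with s hs using hgB s (mem_Ioi.1 hs).le
  rw [subLaplacian_radial h1 h2, e0.deriv.deriv_eq, e0.deriv_eq]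
  simp

section weak

variable {N : ℕ} {p T : ℝ} {u₀ f : Heis N → ℝ} {u : ℝ × Heis N → ℝ} {g : ℝ → ℝ} {b : ℝ}

lemma cutoff_eq_zero (n : ℕ) (hT : 0 < T) (hb : 0 ≤ b)
    (hgb : ∀ s, (b ^ 2) ^ 2 ≤ s → g s = 0) {z : ℝ × Heis N}
    (hz : z ∉ Icc (T / 4) (3 * T / 4) ×ˢ heisBox N b) :
    timeCut n (z.1 / T) * g (heisNorm4 z.2) = 0 := by
  by_cases ht : z.1 ∈ Icc (T / 4) (3 * T / 4)
  · have : z.2 ∉ heisBox N b := fun h => hz ⟨ht, h⟩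
    have h2 : (b ^ 2) ^ 2 < heisNorm4 z.2 := by
      by_contra! h
      exact this (mem_heisBox hb h)
    simp [hgb _ h2.le]
  · simp [timeCut_eq_zero n (div_notMem_Icc hT ht)]

lemma heatTest_eq_zero (n : ℕ) (hT : 0 < T) (hb : 0 ≤ b) (hg : ContDiff ℝ 2 g)
    (hgb : ∀ s, (b ^ 2) ^ 2 ≤ s → g s = 0) {z : ℝ × Heis N}
    (hz : z ∉ Icc (T / 4) (3 * T / 4) ×ˢ heisBox N b) :
    heatTest n T g z = 0 := by
  by_cases ht : z.1 ∈ Icc (T / 4) (3 * T / 4)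
  · have : z.2 ∉ heisBox N b := fun h => hz ⟨ht, h⟩
    have h2 : (b ^ 2) ^ 2 < heisNorm4 z.2 := by
      by_contra! h
      exact this (mem_heisBox hb h)
    simp [heatTest, hgb _ h2.le, subLaplacian_radial_eq_zero hg hgb h2]
  · have := div_notMem_Icc hT ht
    simp [heatTest, timeCut_eq_zero n this, deriv_timeCut_eq_zero n this]

lemma continuous_deriv_timeCut (n : ℕ) : Continuous (deriv (timeCut n)) :=
  (contDiff_timeCut n).continuous_deriv (by norm_num)

lemma integrable_rpow_mul_cutoff (hu : IsWeakSol N p T u₀ f u) (n : ℕ) (hT : 0 < T) (hb : 0 ≤ b)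
    (hg : Continuous g) (hgb : ∀ s, (b ^ 2) ^ 2 ≤ s → g s = 0) :
    Integrable fun z : ℝ × Heis N =>
      |u z| ^ p * (timeCut n (z.1 / T) * g (heisNorm4 z.2)) := by
  have cn : Continuous (heisNorm4 : Heis N → ℝ) := contDiff_heisNorm4.continuous
  have ct := (contDiff_timeCut n).continuous
  exact integrable_mul_of_locallyIntegrableOn hT hu.2.1 (by fun_prop)
    fun z hz => cutoff_eq_zero n hT hb hgb hz

/-- The weak formulation tested against `timeCut n (t / T) * g (|η|_ℍ⁴)`. -/
lemma IsWeakSol.integral_identity (hu : IsWeakSol N p T u₀ f u) (n : ℕ) (hT : 0 < T)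
    (hb : 0 ≤ b) (hg : ContDiff ℝ 2 g) (hg0 : ∀ s, 0 ≤ g s)
    (hgb : ∀ s, (b ^ 2) ^ 2 ≤ s → g s = 0) :
    (∫ z, |u z| ^ p * (timeCut n (z.1 / T) * g (heisNorm4 z.2)))
      + T * (∫ t, timeCut n t) * ∫ η, f η * g (heisNorm4 η) = -∫ z, u z * heatTest n T g z := by
  have cn : Continuous (heisNorm4 : Heis N → ℝ) := contDiff_heisNorm4.continuous
  have ct := (contDiff_timeCut n).continuous
  have ct' := continuous_deriv_timeCut n
  have cL := continuous_subLaplacian_radial (N := N) hg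
  have hg' := hg.continuous
  obtain ⟨h1, h2, -⟩ := hasDerivAt_of_contDiff_two hg
  have hIoo : ∀ t ∉ Ioo (0 : ℝ) T, t / T ∉ Icc (1 / 4 : ℝ) (3 / 4) := fun t ht =>
    div_notMem_Icc hT fun h => ht ⟨by linarith [h.1], by linarith [h.2]⟩
  have hzT : timeCut n (T / T) = 0 := timeCut_eq_zero n (hIoo T (by simp))
  have hz0 : timeCut n 0 = 0 := timeCut_eq_zero n (by norm_num)
  set ψ : ℝ × Heis N → ℝ := fun z => timeCut n (z.1 / T) * g (heisNorm4 z.2) with hψ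
  have htest : IsTestFun N T ψ := by
    refine ⟨?_, ?_, fun z => mul_nonneg (timeCut_nonneg n _) (hg0 _), fun η => by simp [hψ, hzT]⟩
    · exact ((contDiff_timeCut n).comp
        (by fun_prop : ContDiff ℝ 2 fun z : ℝ × Heis N => z.1 / T)).mul
        (hg.comp (contDiff_heisNorm4.comp contDiff_snd))
    · exact HasCompactSupport.intro (isCompact_Icc.prod (isCompact_heisBox N b))
        fun z hz => cutoff_eq_zero n hT hb hgb hz
  have hderiv : ∀ t (η : Heis N), deriv (fun s => ψ (s, η)) t =
      deriv (timeCut n) (t / T) / T * g (heisNorm4 η) := by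
    intro t η
    have := (((hasDerivAt_timeCut n (t / T)).comp t ((hasDerivAt_id t).div_const T)).mul_const
      (g (heisNorm4 η))).deriv
    rw [(hasDerivAt_timeCut n (t / T)).deriv]
    refine this.trans ?_
    ring
  have hlap : ∀ t (η : Heis N), subLaplacian (fun ξ => ψ (t, ξ)) η =
      timeCut n (t / T) * subLaplacian (fun ξ : Heis N => g (heisNorm4 ξ)) η := by
    intro t η
    have := subLaplacian_radial (fun s => (h1 s).const_mul (timeCut n (t / T)))
      (fun s => (h2 s).const_mul (timeCut n (t / T))) η
    refine this.trans ?_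
    rw [subLaplacian_radial h1 h2]
    ring
  have key := hu.2.2 ψ htest
  simp only [hderiv, hlap] at key
  have i0 := integrable_rpow_mul_cutoff hu n hT hb hg' hgb
  have i1 : Integrable fun z : ℝ × Heis N =>
      u z * (deriv (timeCut n) (z.1 / T) / T * g (heisNorm4 z.2)) := by
    refine integrable_mul_of_locallyIntegrableOn (b := b) hT hu.1 (by fun_prop) fun z hz => ?_
    by_cases ht : z.1 ∈ Icc (T / 4) (3 * T / 4)
    · have : z.2 ∉ heisBox N b := fun h => hz ⟨ht, h⟩
      rw [hgb _ (not_lt.1 fun h => this (mem_heisBox hb h.le)), mul_zero]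
    · simp [deriv_timeCut_eq_zero n (div_notMem_Icc hT ht)]
  have i2 : Integrable fun z : ℝ × Heis N => u z *
      (timeCut n (z.1 / T) * subLaplacian (fun ξ : Heis N => g (heisNorm4 ξ)) z.2) := by
    refine integrable_mul_of_locallyIntegrableOn (b := b) hT hu.1 (by fun_prop) fun z hz => ?_
    by_cases ht : z.1 ∈ Icc (T / 4) (3 * T / 4)
    · have : z.2 ∉ heisBox N b := fun h => hz ⟨ht, h⟩
      rw [subLaplacian_radial_eq_zero hg hgb (not_le.1 fun h => this (mem_heisBox hb h)), mul_zero]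
    · simp [timeCut_eq_zero n (div_notMem_Icc hT ht)]
  have e0 := setIntegral_integral_eq (T := T) i0
    fun t ht η => by simp [timeCut_eq_zero n (hIoo t ht)]
  have e1 := setIntegral_integral_eq (T := T) i1
    fun t ht η => by simp [deriv_timeCut_eq_zero n (hIoo t ht)]
  have e2 := setIntegral_integral_eq (T := T) i2
    fun t ht η => by simp [timeCut_eq_zero n (hIoo t ht)]
  have ef : ∫ t in Ioo (0 : ℝ) T, ∫ η, f η * ψ (t, η) =
      T * (∫ t, timeCut n t) * ∫ η, f η * g (heisNorm4 η) := by
    have : ∀ t, ∫ η, f η * ψ (t, η) = timeCut n (t / T) * ∫ η, f η * g (heisNorm4 η) := by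
      intro t
      rw [← integral_const_mul]
      exact integral_congr_ae (Filter.Eventually.of_forall fun η => by simp only [hψ]; ring)
    simp only [this]
    rw [integral_mul_const, integral_timeCut_div n hT]
  have e3 : ∫ η, u₀ η * ψ (0, η) = 0 := by simp [hψ, hz0]
  rw [e3, ef, e0, e1, e2] at key
  have e4 : ∫ z, u z * heatTest n T g z = (∫ z, u z * (deriv (timeCut n) (z.1 / T) / T *
      g (heisNorm4 z.2))) + ∫ z, u z * (timeCut n (z.1 / T) *
        subLaplacian (fun ξ : Heis N => g (heisNorm4 ξ)) z.2) := by
    rw [← integral_add i1 i2]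
    exact integral_congr_ae (Filter.Eventually.of_forall fun z => by simp only [heatTest]; ring)
  rw [e4]
  linarith

end weak

lemma young_scaled {p κ a c : ℝ} (hp : 1 < p) (hκ : 0 < κ) (ha : 0 ≤ a) (hc : 0 ≤ c) :
    a * c ≤ κ * a ^ p + κ ^ (-(1 / (p - 1))) * c ^ (p / (p - 1)) := by
  have hp0 : 0 < p := by linarith
  have hp1 : 0 < p - 1 := by linarith
  have hpq : p.HolderConjugate (p / (p - 1)) := Real.HolderConjugate.conjExponent hp
  have h := Real.young_inequality_of_nonneg (a := κ ^ (1 / p) * a) (b := κ ^ (-(1 / p)) * c)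
    (by positivity) (by positivity) hpq
  have e1 : κ ^ (1 / p) * a * (κ ^ (-(1 / p)) * c) = a * c := by
    rw [Real.rpow_neg hκ.le]
    have := (Real.rpow_pos_of_pos hκ (1 / p)).ne'
    field_simp
  have e2 : (κ ^ (1 / p) * a) ^ p = κ * a ^ p := by
    rw [Real.mul_rpow (by positivity) ha, ← Real.rpow_mul hκ.le, one_div_mul_cancel hp0.ne',
      Real.rpow_one]
  have e3 : (κ ^ (-(1 / p)) * c) ^ (p / (p - 1)) =
      κ ^ (-(1 / (p - 1))) * c ^ (p / (p - 1)) := by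
    rw [Real.mul_rpow (by positivity) hc, ← Real.rpow_mul hκ.le]
    congr 2
    field_simp
  rw [e1, e2, e3] at h
  have hq : 1 ≤ p / (p - 1) := by rw [le_div_iff₀ hp1]; linarith
  exact h.trans (add_le_add (div_le_self (by positivity) hp.le)
    (div_le_self (by positivity) hq))

lemma abs_integral_mul_le {α : Type*} [MeasurableSpace α] {μ : Measure α} {p κ m : ℝ}
    (hp : 1 < p) (hκ : 0 < κ) (hm : 0 ≤ m) {u G W : α → ℝ} {S : Set α} (hS : MeasurableSet S)
    (hSf : μ S ≠ ⊤) (hW : ∀ z, 0 ≤ W z) (hG0 : ∀ z ∉ S, G z = 0)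
    (hG : ∀ z, |G z| ≤ m * W z ^ (1 / p)) (hi : Integrable (fun z => |u z| ^ p * W z) μ) :
    |∫ z, u z * G z ∂μ| ≤
      κ * (∫ z, |u z| ^ p * W z ∂μ) + κ ^ (-(1 / (p - 1))) * m ^ (p / (p - 1)) * μ.real S := by
  have hp0 : 0 < p := by linarith
  set k := κ ^ (-(1 / (p - 1))) * m ^ (p / (p - 1)) with hk
  have hk0 : 0 ≤ k := by positivity
  have hiS : Integrable (S.indicator fun _ => k) μ :=
    (integrable_indicator_iff hS).2 (integrableOn_const hSf)
  have h := norm_integral_le_of_norm_le (f := fun z => u z * G z)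
    (g := fun z => κ * (|u z| ^ p * W z) + S.indicator (fun _ => k) z)
    ((hi.const_mul κ).add hiS) (Filter.Eventually.of_forall fun z => ?_)
  · rw [integral_add (hi.const_mul κ) hiS, integral_const_mul, integral_indicator_const k hS,
      smul_eq_mul, Real.norm_eq_abs] at h
    linarith
  · have hWz := hW z
    rw [Real.norm_eq_abs, abs_mul]
    by_cases hz : z ∈ S
    · rw [indicator_of_mem hz]
      have hy := young_scaled hp hκ (a := |u z| * W z ^ (1 / p)) (by positivity) hm
      rw [Real.mul_rpow (abs_nonneg _) (by positivity), ← Real.rpow_mul hWz,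
        one_div_mul_cancel hp0.ne', Real.rpow_one] at hy
      calc |u z| * |G z| ≤ |u z| * (m * W z ^ (1 / p)) := by gcongr; exact hG z
        _ = |u z| * W z ^ (1 / p) * m := by ring
        _ ≤ _ := hy
    · rw [indicator_of_notMem hz, hG0 z hz]
      simp only [abs_zero, mul_zero, add_zero]
      positivity

lemma tendsto_integral_mul_cutoff {N : ℕ} {f : Heis N → ℝ} (hf : Integrable f) {g : ℝ → ℝ}
    (hg : Continuous g) (hg1 : ∀ s, 0 ≤ s → |g s| ≤ 1) (hg0 : g 0 = 1) :
    Filter.Tendsto (fun T : ℝ => ∫ η, f η * g (heisNorm4 η / T ^ 2)) Filter.atTop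
      (nhds (∫ η, f η)) := by
  have cn : Continuous (heisNorm4 : Heis N → ℝ) := contDiff_heisNorm4.continuous
  refine tendsto_integral_filter_of_dominated_convergence (fun η => |f η|)
    (Filter.Eventually.of_forall fun T => ?_) (Filter.Eventually.of_forall fun T =>
      Filter.Eventually.of_forall fun η => ?_) hf.abs (Filter.Eventually.of_forall fun η => ?_)
  · exact hf.aestronglyMeasurable.mul
      (by fun_prop : Continuous fun η : Heis N => g (heisNorm4 η / T ^ 2)).aestronglyMeasurable
  · rw [Real.norm_eq_abs, abs_mul]
    exact mul_le_of_le_one_right (abs_nonneg _)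
      (hg1 _ (div_nonneg (heisNorm4_nonneg η) (sq_nonneg T)))
  · have h1 : Filter.Tendsto (fun T : ℝ => heisNorm4 η / T ^ 2) Filter.atTop (nhds 0) :=
      Filter.Tendsto.const_div_atTop (Filter.tendsto_pow_atTop two_ne_zero) _
    have h2 := ((hg.tendsto 0).comp h1).const_mul (f η)
    simpa [hg0] using h2

lemma polyCut_div_eq_zero (n : ℕ) {T : ℝ} (hT : 0 < T) {s : ℝ} (hs : T ^ 2 ≤ s) :
    polyCut n (s / T ^ 2) = 0 :=
  polyCut_eq_zero n ((one_le_div₀ (by positivity)).2 hs)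

lemma contDiff_polyCut_div (n : ℕ) (T : ℝ) : ContDiff ℝ 2 fun s => polyCut n (s / T ^ 2) :=
  (contDiff_polyCut n).comp (by fun_prop)

lemma abs_subLaplacian_polyCut_le {N : ℕ} {p : ℝ} (hp : 1 < p) {n : ℕ}
    (hn : 2 * p ≤ (n + 3) * (p - 1)) {T : ℝ} (hT : 0 < T) (η : Heis N) :
    |subLaplacian (fun ξ : Heis N => polyCut n (heisNorm4 ξ / T ^ 2)) η| ≤
      (16 * ((n + 3) * (n + 2)) + (8 * N + 16) * (n + 3)) / T *
        polyCut n (heisNorm4 η / T ^ 2) ^ (1 / p) := by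
  rcases lt_or_ge (T ^ 2) (heisNorm4 η) with h | h
  · rw [subLaplacian_radial_eq_zero (contDiff_polyCut_div n T)
      (fun s hs => polyCut_div_eq_zero n hT hs) h, abs_zero]
    have := polyCut_nonneg n (heisNorm4 η / T ^ 2)
    positivity
  have hTs : Real.sqrt T ^ 2 = T := Real.sq_sqrt hT.le
  have hr : heisHorizSq η ≤ T := by
    have := heisHorizSq_le (η := η) (b := Real.sqrt T) (by rwa [hTs])
    rwa [hTs] at this
  have hr0 := heisHorizSq_nonneg η
  have hρ0 := heisNorm4_nonneg η
  have hs0 : 0 ≤ heisNorm4 η / T ^ 2 := by positivity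
  have d1 : ∀ s, HasDerivAt (fun s => polyCut n (s / T ^ 2))
      (-((n + 3) * max 0 (1 - s / T ^ 2) ^ (n + 2)) * (1 / T ^ 2)) s := by
    intro s
    have := (hasDerivAt_polyCut n (s / T ^ 2)).comp s ((hasDerivAt_id s).div_const (T ^ 2))
    exact this
  have d2 : ∀ s, HasDerivAt
      (fun s => -((n + 3) * max 0 (1 - s / T ^ 2) ^ (n + 2)) * (1 / T ^ 2))
      ((n + 3) * (n + 2) * max 0 (1 - s / T ^ 2) ^ (n + 1) * (1 / T ^ 2) * (1 / T ^ 2)) s := by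
    intro s
    have := ((hasDerivAt_deriv_polyCut n (s / T ^ 2)).comp s
      ((hasDerivAt_id s).div_const (T ^ 2))).mul_const (1 / T ^ 2)
    rw [deriv_polyCut] at this
    exact this
  rw [subLaplacian_radial d1 d2]
  have m1 := max_pow_le_polyCut_rpow hp hn (k := n + 1) le_rfl hs0
  have m2 := max_pow_le_polyCut_rpow hp hn (k := n + 2) (by omega) hs0
  set P := polyCut n (heisNorm4 η / T ^ 2) ^ (1 / p)
  have hP : 0 ≤ P := Real.rpow_nonneg (polyCut_nonneg n _) _
  refine (abs_add_le _ _).trans ?_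
  refine (add_le_add (b := 16 * ((n + 3) * (n + 2)) / T * P)
    (d := (8 * N + 16) * (n + 3) / T * P) ?_ ?_).trans_eq (by ring)
  · rw [abs_of_nonneg (by positivity)]
    calc 16 * heisHorizSq η * heisNorm4 η * ((n + 3) * (n + 2) *
          max 0 (1 - heisNorm4 η / T ^ 2) ^ (n + 1) * (1 / T ^ 2) * (1 / T ^ 2))
        ≤ 16 * T * T ^ 2 * ((n + 3) * (n + 2) * P * (1 / T ^ 2) * (1 / T ^ 2)) := by gcongr
      _ = _ := by field_simp
  · rw [neg_mul, mul_neg, abs_neg, abs_of_nonneg (by positivity)]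
    calc (8 * N + 16) * heisHorizSq η * ((n + 3) *
          max 0 (1 - heisNorm4 η / T ^ 2) ^ (n + 2) * (1 / T ^ 2))
        ≤ (8 * N + 16) * T * ((n + 3) * P * (1 / T ^ 2)) := by gcongr
      _ = _ := by field_simp

lemma volume_real_slab (N : ℕ) {T b : ℝ} (hT : 0 < T) (hb : 0 ≤ b) :
    (volume : Measure (ℝ × Heis N)).real (Icc (T / 4) (3 * T / 4) ×ˢ heisBox N b) =
      T / 2 * (2 ^ (2 * N + 1) * (b ^ 2) ^ (N + 1)) := by
  rw [← volume_real_heisBox N hb, show T / 2 = 3 * T / 4 - T / 4 by ring,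
    ← Real.volume_real_Icc_of_le (by linarith : T / 4 ≤ 3 * T / 4)]
  exact measureReal_prod_prod _ _

lemma isCompact_slab (N : ℕ) (T b : ℝ) :
    IsCompact (Icc (T / 4) (3 * T / 4) ×ˢ heisBox N b) :=
  isCompact_Icc.prod (isCompact_heisBox N b)

/-- The `L^p` energy of `u` weighted by the parabolic cut-off at scale `T`. -/
def cutEnergy {N : ℕ} (n : ℕ) (p T : ℝ) (u : ℝ × Heis N → ℝ) : ℝ :=
  ∫ z : ℝ × Heis N, |u z| ^ p * (timeCut n (z.1 / T) * polyCut n (heisNorm4 z.2 / T ^ 2))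

section estimates

variable {N : ℕ} {p : ℝ} {u₀ f : Heis N → ℝ} {u : ℝ × Heis N → ℝ} {n : ℕ}

/-- The a priori estimate given by the test function method. -/
lemma exists_cutEnergy_le (hp : 1 < p) (hn : 2 * p ≤ (n + 3) * (p - 1))
    (hu : ∀ T > (0 : ℝ), IsWeakSol N p T u₀ f u) :
    ∃ K, ∀ T > (0 : ℝ), cutEnergy n p T u / T
      + 2 * (∫ t, timeCut n t) * (∫ η, f η * polyCut n (heisNorm4 η / T ^ 2)) ≤
        K * T ^ ((2 * (N : ℝ) + 2) / 2 - p / (p - 1)) := by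
  set C : ℝ := 8 * (n + 3) + (16 * ((n + 3) * (n + 2)) + (8 * N + 16) * (n + 3)) with hC
  set K : ℝ := (1 / 2) ^ (-(1 / (p - 1))) * C ^ (p / (p - 1)) * 2 ^ (2 * N + 1) with hK
  refine ⟨K, fun T hT => ?_⟩
  have hp0 : 0 < p := by linarith
  have hTs : Real.sqrt T ^ 2 = T := Real.sq_sqrt hT.le
  have hg0 : ∀ s, 0 ≤ polyCut n (s / T ^ 2) := fun s => polyCut_nonneg n _
  have hgb : ∀ s, (Real.sqrt T ^ 2) ^ 2 ≤ s → polyCut n (s / T ^ 2) = 0 := by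
    rw [hTs]; exact fun s hs => polyCut_div_eq_zero n hT hs
  have hg := contDiff_polyCut_div n T
  have hid := (hu T hT).integral_identity n hT (Real.sqrt_nonneg T) hg hg0 hgb
  have hint := integrable_rpow_mul_cutoff (hu T hT) n hT (Real.sqrt_nonneg T) hg.continuous hgb
  have hbound : ∀ z : ℝ × Heis N, |heatTest n T (fun s => polyCut n (s / T ^ 2)) z| ≤
      C / T * (timeCut n (z.1 / T) * polyCut n (heisNorm4 z.2 / T ^ 2)) ^ (1 / p) := by
    intro z
    have hρ : 0 ≤ heisNorm4 z.2 / T ^ 2 := div_nonneg (heisNorm4_nonneg _) (sq_nonneg T)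
    rw [Real.mul_rpow (timeCut_nonneg n _) (polyCut_nonneg n _)]
    have b1 := abs_deriv_timeCut_le hp hn (z.1 / T)
    have b2 := abs_subLaplacian_polyCut_le hp hn hT z.2
    have hp1 : 1 / p ≤ 1 := (div_le_one hp0).2 hp.le
    have b3 := Real.self_le_rpow_of_le_one (timeCut_nonneg n (z.1 / T)) (timeCut_le_one n _) hp1
    have b4 := Real.self_le_rpow_of_le_one (hg0 (heisNorm4 z.2)) (polyCut_le_one n hρ) hp1
    have p1 := timeCut_nonneg n (z.1 / T)
    have p2 := hg0 (heisNorm4 z.2)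
    set a := timeCut n (z.1 / T)
    set c := polyCut n (heisNorm4 z.2 / T ^ 2)
    calc |heatTest n T (fun s => polyCut n (s / T ^ 2)) z|
        ≤ |deriv (timeCut n) (z.1 / T)| / T * c + a *
          |subLaplacian (fun ξ : Heis N => polyCut n (heisNorm4 ξ / T ^ 2)) z.2| := by
          refine (abs_add_le _ _).trans_eq ?_
          rw [abs_mul, abs_mul, abs_div, abs_of_pos hT, abs_of_nonneg p1, abs_of_nonneg p2]
      _ ≤ 8 * (n + 3) * a ^ (1 / p) / T * c ^ (1 / p) + a ^ (1 / p) *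
          ((16 * ((n + 3) * (n + 2)) + (8 * N + 16) * (n + 3)) / T * c ^ (1 / p)) := by gcongr
      _ = _ := by rw [hC]; ring
  have hmain := abs_integral_mul_le hp (κ := 1 / 2) (by norm_num) (m := C / T) (by positivity)
    (isCompact_slab N T (Real.sqrt T)).measurableSet (isCompact_slab N T _).measure_ne_top
    (fun z => mul_nonneg (timeCut_nonneg n _) (hg0 (heisNorm4 z.2)))
    (fun z hz => heatTest_eq_zero n hT (Real.sqrt_nonneg T) hg hgb hz) hbound hint
  rw [volume_real_slab N hT (Real.sqrt_nonneg T), hTs] at hmain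
  have hle := (neg_le_abs _).trans hmain
  rw [← hid] at hle
  have hA : cutEnergy n p T u =
    ∫ z : ℝ × Heis N, |u z| ^ p * (timeCut n (z.1 / T) * polyCut n (heisNorm4 z.2 / T ^ 2)) := rfl
  rw [← hA] at hle
  have hpow : (1 / 2 : ℝ) ^ (-(1 / (p - 1))) * (C / T) ^ (p / (p - 1)) *
      (T / 2 * (2 ^ (2 * N + 1) * T ^ (N + 1))) =
      T * (K * T ^ ((2 * (N : ℝ) + 2) / 2 - p / (p - 1))) / 2 := by
    rw [show (2 * (N : ℝ) + 2) / 2 = ((N + 1 : ℕ) : ℝ) by push_cast; ring, Real.rpow_sub hT,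
      Real.rpow_natCast, Real.div_rpow (by positivity) hT.le, hK]
    field_simp
  rw [hpow] at hle
  rw [← mul_le_mul_iff_right₀ hT, mul_add, mul_div_cancel₀ _ hT.ne']
  linarith

/-- If `∫ f ≥ 0`, then the averaged energy vanishes at infinity, so the integral of `f` against
every radial test function is nonpositive. -/
lemma integral_mul_radial_nonpos (hp : 1 < p) (hn : 2 * p ≤ (n + 3) * (p - 1))
    (hlam : (2 * (N : ℝ) + 2) / 2 - p / (p - 1) < 0) (hf : Integrable f)
    (hu : ∀ T > (0 : ℝ), IsWeakSol N p T u₀ f u) (hf0 : 0 ≤ ∫ η, f η)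
    {g : ℝ → ℝ} (hg : ContDiff ℝ 2 g) (hg0 : ∀ s, 0 ≤ g s) (hg1 : ∀ s, g s ≤ 1) {b : ℝ}
    (hb : 0 ≤ b) (hgb : ∀ s, (b ^ 2) ^ 2 ≤ s → g s = 0) :
    ∫ η, f η * g (heisNorm4 η) ≤ 0 := by
  obtain ⟨K, hK⟩ := exists_cutEnergy_le hp hn hu
  have hp0 : 0 < p := by linarith
  have hp1 : 0 < p - 1 := by linarith
  have hc := integral_timeCut_pos n
  set c := ∫ t, timeCut n t with hcdef
  obtain ⟨L, hL⟩ : ∃ L, ∀ η : Heis N, |subLaplacian (fun ξ : Heis N => g (heisNorm4 ξ)) η| ≤ L := by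
    have hcs : HasCompactSupport
        fun η : Heis N => subLaplacian (fun ξ : Heis N => g (heisNorm4 ξ)) η :=
      HasCompactSupport.intro (isCompact_heisBox N b) fun η hη =>
        subLaplacian_radial_eq_zero hg hgb (not_le.1 fun h => hη (mem_heisBox hb h))
    exact hcs.exists_bound_of_continuous (continuous_subLaplacian_radial hg)
  have hL0 : 0 ≤ L := (abs_nonneg _).trans (hL 0)
  set M : ℝ := (8 * (n + 3) + L) * 2 ^ (n + 3) with hM
  set V : ℝ := M ^ (p / (p - 1)) * (1 / 2 * (2 ^ (2 * N + 1) * (b ^ 2) ^ (N + 1))) with hV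
  have step : ∀ κ > (0 : ℝ), ∀ T, 1 ≤ T → 2 * (b ^ 2) ^ 2 ≤ T ^ 2 →
      c * ∫ η, f η * g (heisNorm4 η) ≤ κ * (cutEnergy n p T u / T) + κ ^ (-(1 / (p - 1))) * V := by
    intro κ hκ T hT1 hTb
    have hT : 0 < T := by linarith
    have hTs : Real.sqrt T ^ 2 = T := Real.sq_sqrt hT.le
    have hid := (hu T hT).integral_identity n hT hb hg hg0 hgb
    have hint := integrable_rpow_mul_cutoff (hu T hT) n hT (Real.sqrt_nonneg T)
      (contDiff_polyCut_div n T).continuous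
      (by rw [hTs]; exact fun s hs => polyCut_div_eq_zero n hT hs)
    have hA : 0 ≤ ∫ z, |u z| ^ p * (timeCut n (z.1 / T) * g (heisNorm4 z.2)) :=
      integral_nonneg fun z => mul_nonneg (by positivity)
        (mul_nonneg (timeCut_nonneg n _) (hg0 _))
    have hbound : ∀ z : ℝ × Heis N, |heatTest n T g z| ≤
        M * (timeCut n (z.1 / T) * polyCut n (heisNorm4 z.2 / T ^ 2)) ^ (1 / p) := by
      intro z
      have p1 := timeCut_nonneg n (z.1 / T)
      have p2 := polyCut_nonneg n (heisNorm4 z.2 / T ^ 2)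
      rcases lt_or_ge ((b ^ 2) ^ 2) (heisNorm4 z.2) with h | h
      · rw [heatTest, hgb _ h.le, subLaplacian_radial_eq_zero hg hgb h, mul_zero, mul_zero,
          add_zero, abs_zero]
        positivity
      rw [Real.mul_rpow p1 p2]
      have hρ : 0 ≤ heisNorm4 z.2 / T ^ 2 := div_nonneg (heisNorm4_nonneg _) (sq_nonneg T)
      have hhalf : heisNorm4 z.2 / T ^ 2 ≤ 1 / 2 := by
        rw [div_le_iff₀ (by positivity)]; linarith
      have hpi : 1 / p ≤ 1 := (div_le_one hp0).2 hp.le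
      have b1 := abs_deriv_timeCut_le hp hn (z.1 / T)
      have b3 := Real.self_le_rpow_of_le_one p1 (timeCut_le_one n _) hpi
      have b4 := Real.self_le_rpow_of_le_one p2 (polyCut_le_one n hρ) hpi
      have b5 : (1 / 2) ^ (n + 3) ≤ polyCut n (heisNorm4 z.2 / T ^ 2) := by
        unfold polyCut
        gcongr
        exact le_max_of_le_right (by linarith)
      have b6 : 1 ≤ 2 ^ (n + 3) * polyCut n (heisNorm4 z.2 / T ^ 2) ^ (1 / p) := by
        calc (1 : ℝ) = 2 ^ (n + 3) * (1 / 2) ^ (n + 3) := by rw [← mul_pow]; norm_num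
          _ ≤ _ := by gcongr; exact b5.trans b4
      set a := timeCut n (z.1 / T)
      set d := polyCut n (heisNorm4 z.2 / T ^ 2)
      have hga := hg1 (heisNorm4 z.2)
      have hgp := hg0 (heisNorm4 z.2)
      have hLz := hL z.2
      have ha := Real.rpow_nonneg p1 (1 / p)
      calc |heatTest n T g z|
          ≤ |deriv (timeCut n) (z.1 / T)| / T * g (heisNorm4 z.2) + a *
            |subLaplacian (fun ξ : Heis N => g (heisNorm4 ξ)) z.2| := by
            refine (abs_add_le _ _).trans_eq ?_
            rw [abs_mul, abs_mul, abs_div, abs_of_pos hT, abs_of_nonneg p1, abs_of_nonneg hgp]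
        _ ≤ 8 * (n + 3) * a ^ (1 / p) / 1 * 1 + a ^ (1 / p) * L := by gcongr
        _ = (8 * (n + 3) + L) * a ^ (1 / p) * 1 := by ring
        _ ≤ (8 * (n + 3) + L) * a ^ (1 / p) * (2 ^ (n + 3) * d ^ (1 / p)) := by gcongr
        _ = _ := by rw [hM]; ring
    have hmain := abs_integral_mul_le hp hκ (m := M) (by positivity)
      (isCompact_slab N T b).measurableSet (isCompact_slab N T b).measure_ne_top
      (fun z => mul_nonneg (timeCut_nonneg n _) (polyCut_nonneg n (heisNorm4 z.2 / T ^ 2)))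
      (fun z hz => heatTest_eq_zero n hT hb hg hgb hz) hbound hint
    rw [volume_real_slab N hT hb] at hmain
    have hle := (neg_le_abs _).trans hmain
    rw [← hid] at hle
    have hAT : cutEnergy n p T u = ∫ z : ℝ × Heis N,
      |u z| ^ p * (timeCut n (z.1 / T) * polyCut n (heisNorm4 z.2 / T ^ 2)) := rfl
    rw [← hAT] at hle
    rw [← mul_le_mul_iff_right₀ hT, mul_add]
    have e : T * (κ * (cutEnergy n p T u / T)) = κ * cutEnergy n p T u := by field_simp
    rw [e, hV]
    linarith
  have hcont : Continuous (polyCut n) := (contDiff_polyCut n).continuous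
  have hlimf := tendsto_integral_mul_cutoff hf hcont
    (fun s hs => by rw [abs_of_nonneg (polyCut_nonneg n s)]; exact polyCut_le_one n hs)
    (by simp [polyCut])
  have hlimT : Filter.Tendsto (fun T : ℝ => T ^ ((2 * (N : ℝ) + 2) / 2 - p / (p - 1)))
      Filter.atTop (nhds 0) := by
    simpa using tendsto_rpow_neg_atTop (neg_pos.2 hlam)
  have step2 : ∀ κ > (0 : ℝ),
      c * ∫ η, f η * g (heisNorm4 η) ≤ κ ^ (-(1 / (p - 1))) * V := by
    intro κ hκ
    have hlim := (((hlimT.const_mul K).sub (hlimf.const_mul (2 * c))).const_mul κ).add_const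
      (κ ^ (-(1 / (p - 1))) * V)
    have hle := ge_of_tendsto hlim (b := c * ∫ η, f η * g (heisNorm4 η)) (by
      filter_upwards [Filter.eventually_ge_atTop 1,
        (Filter.tendsto_pow_atTop (two_ne_zero)).eventually_ge_atTop (2 * (b ^ 2) ^ 2)]
        with T hT1 hTb
      refine (step κ hκ T hT1 hTb).trans ?_
      have := hK T (by linarith)
      gcongr
      linarith)
    have : 0 ≤ κ * (2 * c * ∫ η, f η) := by positivity
    linarith
  have hlimκ : Filter.Tendsto (fun κ : ℝ => κ ^ (-(1 / (p - 1))) * V) Filter.atTop (nhds 0) := by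
    simpa using (tendsto_rpow_neg_atTop (by positivity : 0 < 1 / (p - 1))).mul_const V
  have h := ge_of_tendsto hlimκ (by
    filter_upwards [Filter.eventually_gt_atTop 0] with κ hκ using step2 κ hκ)
  by_contra! hpos
  exact absurd h (not_le.2 (mul_pos hc hpos))

end estimates

lemma contDiff_comp_abs {Φ : ℝ → ℝ} (hΦ : ContDiffOn ℝ 2 Φ (Ici (0 : ℝ)))
    (hΦ1 : ∀ s ∈ Icc (0 : ℝ) 1, Φ s = 1) : ContDiff ℝ 2 fun s => Φ |s| := by
  rw [contDiff_iff_contDiffAt]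
  intro s
  by_cases hs : s = 0
  · refine contDiffAt_const (c := (1 : ℝ)) |>.congr_of_eventuallyEq ?_
    filter_upwards [Metric.ball_mem_nhds s one_pos] with t ht
    rw [hs, mem_ball_zero_iff, Real.norm_eq_abs] at ht
    exact hΦ1 _ ⟨abs_nonneg t, ht.le⟩
  · exact (hΦ.contDiffAt (Ici_mem_nhds (abs_pos.2 hs))).comp s (contDiffAt_abs hs)

lemma critical_exponent_neg {N : ℕ} (hN : 1 ≤ N) {p : ℝ} (hp1 : 1 < p)
    (hp2 : p < (2 * (N : ℝ) + 2) / ((2 * (N : ℝ) + 2) - 2)) :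
    (2 * (N : ℝ) + 2) / 2 - p / (p - 1) < 0 := by
  have hN' : (0 : ℝ) < N := by exact_mod_cast hN
  rw [lt_div_iff₀ (by linarith)] at hp2
  rw [sub_neg, lt_div_iff₀ (by linarith)]
  linarith

/-- if `1 < p < Q/(Q−2)` and `u` is a global weak solution of
`u_t − Δ_ℍ u = |u|^p + f` with nonnegative datum `u₀`, then for every standard cut-off `Φ`,
`∫ f Φ(|η|_ℍ⁴/T²) dη ≤ C T^λ` for all large `T`, where `λ = Q/2 − p/(p−1) < 0`. -/
theorem weighted_forcing_integral_bound {N : ℕ} (hN : 1 ≤ N) (p : ℝ)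
    (hp1 : 1 < p) (hp2 : p < (2 * (N : ℝ) + 2) / ((2 * (N : ℝ) + 2) - 2))
    (u₀ : Heis N → ℝ) (hu₀ : LocallyIntegrable u₀ (volume : Measure (Heis N)))
    (hu₀0 : ∀ η, 0 ≤ u₀ η)
    (f : Heis N → ℝ) (hf : Integrable f (volume : Measure (Heis N)))
    (u : ℝ × Heis N → ℝ) (hu : ∀ T > (0 : ℝ), IsWeakSol N p T u₀ f u)
    (Φ : ℝ → ℝ) (hΦ : ContDiffOn ℝ 2 Φ (Ici (0 : ℝ)))
    (hΦ01 : ∀ s, Φ s ∈ Icc (0 : ℝ) 1)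
    (hΦ1 : ∀ s ∈ Icc (0 : ℝ) 1, Φ s = 1)
    (hΦ0 : ∀ s ∈ Ici (2 : ℝ), Φ s = 0) :
    (2 * (N : ℝ) + 2) / 2 - p / (p - 1) < 0 ∧
    ∃ C > (0 : ℝ), ∃ T₁ > (0 : ℝ), ∀ T ≥ T₁,
      (∫ η : Heis N, f η * Φ (heisNorm4 η / T ^ 2))
        ≤ C * T ^ ((2 * (N : ℝ) + 2) / 2 - p / (p - 1)) := by
  have hlam := critical_exponent_neg hN hp1 hp2
  refine ⟨hlam, 1, one_pos, ?_⟩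
  have hg := contDiff_comp_abs hΦ hΦ1
  have habs : ∀ (η : Heis N) (T : ℝ), |heisNorm4 η / T ^ 2| = heisNorm4 η / T ^ 2 := fun η T =>
    abs_of_nonneg (div_nonneg (heisNorm4_nonneg η) (sq_nonneg T))
  rcases lt_or_ge (∫ η, f η) 0 with hneg | hnonneg
  · have hlim := tendsto_integral_mul_cutoff hf hg.continuous
      (fun s _ => abs_le.2 ⟨by linarith [(hΦ01 |s|).1], (hΦ01 |s|).2⟩)
      (by simpa using hΦ1 0 (by simp))
    obtain ⟨T₁, hT₁⟩ := Filter.eventually_atTop.1 (hlim.eventually_lt_const hneg)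
    refine ⟨max T₁ 1, by positivity, fun T hT => ?_⟩
    have hT0 : 0 < T := by linarith [le_max_right T₁ 1]
    have h := hT₁ T ((le_max_left _ _).trans hT)
    simp only [habs] at h
    exact h.le.trans (by positivity)
  · refine ⟨1, one_pos, fun T hT => ?_⟩
    have hT0 : 0 < T := by linarith
    obtain ⟨n, hn⟩ := exists_nat_ge (2 * p / (p - 1))
    rw [div_le_iff₀ (by linarith)] at hn
    have h := integral_mul_radial_nonpos (n := n) (g := fun s => Φ |s / T ^ 2|) hp1
      (by nlinarith) hlam hf hu hnonneg
      (hg.comp (by fun_prop : ContDiff ℝ 2 fun s : ℝ => s / T ^ 2))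
      (fun s => (hΦ01 _).1) (fun s => (hΦ01 _).2) (Real.sqrt_nonneg (2 * T)) (by
        rw [Real.sq_sqrt (by positivity)]
        intro s hs
        refine hΦ0 _ (mem_Ici.2 (le_abs.2 (Or.inl ?_)))
        rw [le_div_iff₀ (by positivity)]
        nlinarith [sq_nonneg T])
    simp only [habs] at h
    exact h.trans (by positivity)
end
end
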